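/- arXiv:1802.01210 — 2 statements merged into one kernel-verified Lean document; each statement's English description precedes it below -/
import Mathlib

section
/- Let X be a hypersurface of degree d and dimension n in P^{n+1} over F_q with 0 < k_X ≤ n−1, and suppose N_q(X) = Θ_{n,k_X}^{d,q}. Then d = 2, or d = q+1, or there exists an integer s with q = s^2 and d = s+1. -/
/-- `NP q N` is the number of `F_q`-points of `P^N`, i.e. `q^N + q^(N-1) + … + q + 1`. -/
def NP (q N : ℕ) : ℕ := ∑ i ∈ Finset.range (N + 1), q ^ i

/-- `Theta q d n k` is the quantity `Θ_{n,k}^{d,q} = (d-1)·q^k·N_q(P^{n-k}) + N_q(P^k)`. -/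
def Theta (q d n k : ℕ) : ℕ := (d - 1) * q ^ k * NP q (n - k) + NP q k

/-- The number of `F`-rational points of the hypersurface `f = 0` in `P^{m-1}`. -/
noncomputable def numPoints {F : Type*} [Field F] {m : ℕ}
    (f : MvPolynomial (Fin m) F) : ℕ :=
  Nat.card {p : Projectivization F (Fin m → F) // MvPolynomial.eval p.rep f = 0}

/-- The projective linear subspace `P(W)` is contained in the hypersurface `f = 0`. -/
def SubInX {F : Type*} [Field F] {m : ℕ}
    (f : MvPolynomial (Fin m) F) (W : Submodule F (Fin m → F)) : Prop :=
  ∀ v ∈ W, MvPolynomial.eval v f = 0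

/-- The Thas invariant of the hypersurface `f = 0` equals `k`: there is an `F`-linear
projective subspace of dimension `k` contained in it, and none of dimension `k + 1`. -/
def ThasEq {F : Type*} [Field F] {m : ℕ}
    (f : MvPolynomial (Fin m) F) (k : ℕ) : Prop :=
  (∃ W : Submodule F (Fin m → F), Module.finrank F W = k + 1 ∧ SubInX f W) ∧
  ¬ ∃ W : Submodule F (Fin m → F), Module.finrank F W = k + 2 ∧ SubInX f W

/-- `v` is a homogeneous coordinate vector of a singular `F`-point of `f = 0`. -/
def IsSingPt {F : Type*} [Field F] {m : ℕ}
    (f : MvPolynomial (Fin m) F) (v : Fin m → F) : Prop :=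
  v ≠ 0 ∧ MvPolynomial.eval v f = 0 ∧
    ∀ i, MvPolynomial.eval v (MvPolynomial.pderiv i f) = 0

section LinePoly

open MvPolynomial

variable {σ F : Type*} [Field F]

/-- The restriction of `f` to the parametrised line `s ↦ x + s • u`. -/
noncomputable def linePoly (f : MvPolynomial σ F) (x u : σ → F) : Polynomial F :=
  aeval (fun i => Polynomial.C (x i) + Polynomial.C (u i) * Polynomial.X) f

/-- The derivative of `f` at `x` in the direction `u`, as a linear functional of `u`. -/
noncomputable def dirDeriv [Fintype σ] (f : MvPolynomial σ F) (x : σ → F) : (σ → F) →ₗ[F] F where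
  toFun u := ∑ i, u i * eval x (pderiv i f)
  map_add' u v := by simp [add_mul, Finset.sum_add_distrib]
  map_smul' c u := by simp [Finset.mul_sum, mul_assoc]

theorem eval_linePoly (f : MvPolynomial σ F) (x u : σ → F) (s : F) :
    (linePoly f x u).eval s = eval (x + s • u) f := by
  induction f using MvPolynomial.induction_on with
  | C a => simp [linePoly]
  | add p q hp hq => simp_all [linePoly]
  | mul_X p i hp =>
    simp only [linePoly, map_mul, Polynomial.eval_mul, aeval_X, eval_X] at hp ⊢
    rw [hp]
    simp only [Polynomial.eval_add, Polynomial.eval_mul, Polynomial.eval_C, Polynomial.eval_X,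
      Pi.add_apply, Pi.smul_apply, smul_eq_mul]
    ring

theorem natDegree_linePoly_le (f : MvPolynomial σ F) (x u : σ → F) :
    (linePoly f x u).natDegree ≤ f.totalDegree := by
  have := MvPolynomial.aeval_natDegree_le (m := f.totalDegree) (n := 1) f le_rfl
    (fun i => Polynomial.C (x i) + Polynomial.C (u i) * Polynomial.X)
    (fun i => by
      rw [add_comm]; exact Polynomial.natDegree_linear_le)
  simpa [linePoly] using this

theorem eval_zero_derivative_linePoly [Fintype σ] (f : MvPolynomial σ F) (x u : σ → F) :
    (linePoly f x u).derivative.eval 0 = dirDeriv f x u := by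
  classical
  change _ = ∑ i, u i * eval x (pderiv i f)
  have h0 : ∀ p : MvPolynomial σ F, (linePoly p x u).eval 0 = eval x p := fun p => by
    simp [eval_linePoly]
  induction f using MvPolynomial.induction_on with
  | C a => simp [linePoly]
  | add p q hp hq => simp_all [linePoly, mul_add, Finset.sum_add_distrib]
  | mul_X p i hp =>
    have h1 : linePoly (p * X i) x u =
        linePoly p x u * (Polynomial.C (x i) + Polynomial.C (u i) * Polynomial.X) := by
      simp [linePoly]
    rw [h1, Polynomial.derivative_mul, Polynomial.eval_add, Polynomial.eval_mul,
      Polynomial.eval_mul, hp, h0]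
    have h2 : ∀ j, eval x (pderiv j (p * X i)) =
        eval x (pderiv j p) * x i + eval x p * (if i = j then 1 else 0) := fun j => by
      rw [Derivation.leibniz, pderiv_X, Pi.single_apply]
      split_ifs <;> simp <;> ring
    simp only [h2, mul_add, Finset.sum_add_distrib]
    simp [Finset.sum_mul, mul_assoc, mul_comm (u _)]

theorem coeff_prod_line (x u : σ → F) (a : σ → ℕ) (S : Finset σ) :
    (∏ i ∈ S, (Polynomial.C (x i) + Polynomial.C (u i) * Polynomial.X) ^ a i).natDegree
        ≤ ∑ i ∈ S, a i ∧
    (∏ i ∈ S, (Polynomial.C (x i) + Polynomial.C (u i) * Polynomial.X) ^ a i).coeff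
        (∑ i ∈ S, a i) = ∏ i ∈ S, u i ^ a i := by
  classical
  have hl : ∀ i, (Polynomial.C (x i) + Polynomial.C (u i) * Polynomial.X).natDegree ≤ 1 :=
    fun i => by
      rw [add_comm]; exact Polynomial.natDegree_linear_le
  have hp : ∀ i, ((Polynomial.C (x i) + Polynomial.C (u i) * Polynomial.X) ^ a i).natDegree
      ≤ a i := fun i => by
    simpa using Polynomial.natDegree_pow_le_of_le (a i) (hl i)
  induction S using Finset.induction_on with
  | empty => simp
  | insert i S hi ih =>
    rw [Finset.prod_insert hi, Finset.sum_insert hi, Finset.prod_insert hi]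
    refine ⟨Polynomial.natDegree_mul_le_of_le (hp i) ih.1, ?_⟩
    rw [Polynomial.coeff_mul_add_eq_of_natDegree_le (hp i) ih.1, ih.2]
    congr 1
    have := Polynomial.coeff_pow_of_natDegree_le (m := a i) (hl i)
    rw [mul_one] at this
    rw [this]; simp

theorem coeff_linePoly {f : MvPolynomial σ F} {N : ℕ} (hN : f.totalDegree ≤ N) (x u : σ → F) :
    (linePoly f x u).coeff N = eval u (homogeneousComponent N f) := by
  classical
  rw [homogeneousComponent_apply, linePoly, aeval_def, eval₂_eq, Polynomial.finsetSum_coeff,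
    map_sum, Finset.sum_filter]
  refine Finset.sum_congr rfl fun a ha => ?_
  have hle : a.degree ≤ N := (le_totalDegree ha).trans hN
  have h := coeff_prod_line x u a a.support
  rw [← Polynomial.C_eq_algebraMap, Polynomial.coeff_C_mul]
  split_ifs with hd
  · rw [eval_monomial, ← hd]
    congr 1
    exact h.2
  · rw [Polynomial.coeff_eq_zero_of_natDegree_lt, mul_zero]
    exact h.1.trans_lt (lt_of_le_of_ne hle hd)

theorem coeff_linePoly_of_isHomogeneous {f : MvPolynomial σ F} {N : ℕ} (hf : f.IsHomogeneous N)
    (x u : σ → F) : (linePoly f x u).coeff N = eval u f := by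
  rw [coeff_linePoly hf.totalDegree_le, homogeneousComponent_eq_self hf]

theorem totalDegree_le_of_homogeneousComponent_eq_zero {f : MvPolynomial σ F} {N : ℕ}
    (hN : f.totalDegree ≤ N + 1) (h : homogeneousComponent (N + 1) f = 0) :
    f.totalDegree ≤ N := by
  refine Finset.sup_le fun a ha => ?_
  have h1 : a.degree ≤ N + 1 := (le_totalDegree ha).trans hN
  change a.degree ≤ N
  by_contra hlt
  have h2 : a.degree = N + 1 := by omega
  have := coeff_homogeneousComponent (N + 1) f a
  rw [h, if_pos h2, coeff_zero] at this
  exact (mem_support_iff.1 ha) this.symm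

/-- The pullback of `f` along the affine map `y ↦ e + ∑ j, y j • b j`. -/
noncomputable def affPull {τ : Type*} [Fintype τ] (f : MvPolynomial σ F) (e : σ → F)
    (b : τ → σ → F) : MvPolynomial τ F :=
  aeval (fun i => C (e i) + ∑ j, C (b j i) * X j) f

theorem eval_affPull {τ : Type*} [Fintype τ] (f : MvPolynomial σ F) (e : σ → F)
    (b : τ → σ → F) (y : τ → F) :
    eval y (affPull f e b) = eval (e + ∑ j, y j • b j) f := by
  induction f using MvPolynomial.induction_on with
  | C a => simp [affPull]
  | add p q hp hq => simp_all [affPull]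
  | mul_X p i hp =>
    simp only [affPull, map_mul, aeval_X, eval_X] at hp ⊢
    rw [hp]; simp [mul_comm]

theorem linePoly_affPull {τ : Type*} [Fintype τ] (f : MvPolynomial σ F) (e : σ → F)
    (b : τ → σ → F) (y z : τ → F) :
    linePoly (affPull f e b) y z = linePoly f (e + ∑ j, y j • b j) (∑ j, z j • b j) := by
  induction f using MvPolynomial.induction_on with
  | C a => simp [affPull, linePoly]
  | add p q hp hq => simp_all [affPull, linePoly]
  | mul_X p i hp =>
    simp only [affPull, linePoly, map_mul, aeval_X] at hp ⊢
    rw [hp]; congr 1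
    simp only [map_add, algHom_C, ← Polynomial.C_eq_algebraMap, map_sum, map_mul, aeval_X,
      Pi.add_apply, Finset.sum_apply, Pi.smul_apply, smul_eq_mul, Finset.sum_mul, mul_add,
      Finset.sum_add_distrib]
    simp only [mul_comm, mul_left_comm, add_assoc]

theorem totalDegree_affPull_le {τ : Type*} [Fintype τ] (f : MvPolynomial σ F) (e : σ → F)
    (b : τ → σ → F) : (affPull f e b).totalDegree ≤ f.totalDegree := by
  classical
  have hl : ∀ i, (C (e i) + ∑ j, C (b j i) * X j : MvPolynomial τ F).totalDegree ≤ 1 := fun i => by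
    refine (totalDegree_add _ _).trans (max_le (by simp) ?_)
    refine totalDegree_finsetSum_le fun j _ => ?_
    exact (totalDegree_mul _ _).trans (by simp [totalDegree_X])
  rw [affPull, aeval_def, eval₂_eq]
  refine totalDegree_finsetSum_le fun a ha => ?_
  refine (totalDegree_mul _ _).trans ?_
  rw [algebraMap_eq, totalDegree_C, zero_add]
  refine (totalDegree_finsetProd _ _).trans (le_trans (Finset.sum_le_sum fun i _ => ?_)
    (le_totalDegree ha))
  exact (totalDegree_pow _ _).trans (by simpa using Nat.mul_le_mul_left (a i) (hl i))

theorem isHomogeneous_affPull {τ : Type*} [Fintype τ] {f : MvPolynomial σ F} {N : ℕ}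
    (hf : f.IsHomogeneous N) (b : τ → σ → F) : (affPull f 0 b).IsHomogeneous N := by
  have := hf.aeval (fun i => C ((0 : σ → F) i) + ∑ j, C (b j i) * X j : σ → MvPolynomial τ F)
    (n := 1) (fun i => by
      simp only [Pi.zero_apply, C_0, zero_add]
      exact IsHomogeneous.sum _ _ _ fun j _ => isHomogeneous_C_mul_X _ _)
  simpa [affPull] using this

theorem eval_smul_of_isHomogeneous {f : MvPolynomial σ F} {N : ℕ}
    (hf : f.IsHomogeneous N) (r : F) (x : σ → F) : eval (r • x) f = r ^ N * eval x f := by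
  classical
  rw [eval_eq, eval_eq, Finset.mul_sum]
  refine Finset.sum_congr rfl fun a ha => ?_
  rw [hf.degree_eq_sum_deg_support ha, ← Finset.prod_pow_eq_pow_sum]
  simp only [Pi.smul_apply, smul_eq_mul, mul_pow, Finset.prod_mul_distrib]
  ring

end LinePoly

section Coset

open MvPolynomial
open scoped Classical

variable {F : Type*} [Field F] {m : ℕ}

theorem natDegree_linePoly_le_of_eval_eq_zero {f : MvPolynomial (Fin m) F} {t : ℕ}
    (hf : f.IsHomogeneous (t + 1)) {x u : Fin m → F} (hu : eval u f = 0) :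
    (linePoly f x u).natDegree ≤ t := by
  have h1 := (natDegree_linePoly_le f x u).trans hf.totalDegree_le
  have h2 := coeff_linePoly_of_isHomogeneous hf x u
  rw [hu] at h2
  by_contra hlt
  have h3 : (linePoly f x u).natDegree = t + 1 := by omega
  rw [← h3, Polynomial.coeff_natDegree, Polynomial.leadingCoeff_eq_zero] at h2
  rw [h2] at h3
  simp at h3

variable [Fintype F]

theorem card_filter_mem_submodule (L : Submodule F (Fin m → F)) :
    (Finset.univ.filter fun u => u ∈ L).card = Fintype.card F ^ Module.finrank F L := by
  rw [← Module.card_eq_pow_finrank (K := F) (V := L), Fintype.card_subtype]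

theorem card_zeros_le_mul_pow {k N : ℕ} {p : MvPolynomial (Fin (k + 1)) F} (hp : p ≠ 0)
    (hN : p.totalDegree ≤ N) :
    (Finset.univ.filter fun y => eval y p = 0).card ≤ N * Fintype.card F ^ k := by
  have h := schwartz_zippel_totalDegree hp (Finset.univ : Finset F)
  rw [Fintype.piFinset_univ, Finset.card_univ] at h
  have hq : (0 : ℚ≥0) < Fintype.card F := by exact_mod_cast Fintype.card_pos
  rw [div_le_div_iff₀ (by positivity) hq, pow_succ, ← mul_assoc] at h
  have h' := le_of_mul_le_mul_right h hq
  have h2 : (Finset.univ.filter fun y => eval y p = 0).card ≤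
      p.totalDegree * Fintype.card F ^ k := by exact_mod_cast h'
  exact h2.trans (Nat.mul_le_mul_right _ hN)

theorem polynomial_eq_zero_of_forall_eval {h : Polynomial F} {t : ℕ} (hd : h.natDegree ≤ t)
    (ht : t < Fintype.card F) (h0 : ∀ s, h.eval s = 0) : h = 0 := by
  by_contra hne
  have h1 : (Finset.univ : Finset F) ⊆ h.roots.toFinset := fun s _ => by
    simp [hne, h0 s]
  have h2 := (Finset.card_le_card h1).trans (Multiset.toFinset_card_le _)
  have := h2.trans (Polynomial.card_roots' h)
  rw [Finset.card_univ] at this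
  omega

theorem card_zeros_le_natDegree {h : Polynomial F} (hne : h ≠ 0) :
    (Finset.univ.filter fun s => h.eval s = 0).card ≤ h.natDegree := by
  have h1 : (Finset.univ.filter fun s => h.eval s = 0) ⊆ h.roots.toFinset := fun s hs => by
    simpa [hne] using hs
  exact ((Finset.card_le_card h1).trans (Multiset.toFinset_card_le _)).trans
    (Polynomial.card_roots' h)

theorem card_zeros_lt_natDegree {h : Polynomial F} (hne : h ≠ 0) (h0 : h.eval 0 = 0)
    (h1 : h.derivative.eval 0 = 0) :
    (Finset.univ.filter fun s => h.eval s = 0).card < h.natDegree := by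
  have hm := (Polynomial.one_lt_rootMultiplicity_iff_isRoot hne).2 ⟨h0, h1⟩
  rw [← Polynomial.count_roots] at hm
  have h2 : (Finset.univ.filter fun s => h.eval s = 0) ⊆ (h.roots.erase 0).toFinset :=
    fun s hs => by
      have hs' : s ∈ h.roots := by simpa [hne] using hs
      rw [Multiset.mem_toFinset]
      by_cases hs0 : s = 0
      · subst hs0
        rw [← Multiset.count_pos, Multiset.count_erase_self]; omega
      · exact (Multiset.mem_erase_of_ne hs0).2 hs'
  have h3 := (Finset.card_le_card h2).trans (Multiset.toFinset_card_le _)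
  have h4 : (0 : F) ∈ h.roots := by simpa [hne] using h0
  have h5 := Multiset.card_erase_lt_of_mem h4
  have h6 := Polynomial.card_roots' h
  omega

/-- The vectors `u ∈ L` such that `e + u` is a zero of `f`. -/
noncomputable def cosetZeros (f : MvPolynomial (Fin m) F) (L : Submodule F (Fin m → F))
    (e : Fin m → F) : Finset (Fin m → F) :=
  Finset.univ.filter fun u => u ∈ L ∧ eval (e + u) f = 0

theorem mem_cosetZeros {f : MvPolynomial (Fin m) F} {L : Submodule F (Fin m → F)}
    {e u : Fin m → F} : u ∈ cosetZeros f L e ↔ u ∈ L ∧ eval (e + u) f = 0 := by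
  simp [cosetZeros]

theorem dirDeriv_eq_zero_of_line {f : MvPolynomial (Fin m) F} {t : ℕ}
    (hf : f.IsHomogeneous (t + 1)) (htq : t + 1 ≤ Fintype.card F) {x u : Fin m → F}
    (hu : eval u f = 0) (h : ∀ s : F, eval (x + s • u) f = 0) : dirDeriv f x u = 0 := by
  have : linePoly f x u = 0 := polynomial_eq_zero_of_forall_eval
    (natDegree_linePoly_le_of_eval_eq_zero hf hu) (by omega) fun s => by rw [eval_linePoly, h]
  rw [← eval_zero_derivative_linePoly, this]; simp

theorem dirDeriv_eq_zero_of_mem {f : MvPolynomial (Fin m) F} {t : ℕ}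
    (hf : f.IsHomogeneous (t + 1)) (htq : t + 1 ≤ Fintype.card F) {L : Submodule F (Fin m → F)}
    (hL : ∀ v ∈ L, eval v f = 0) {x u : Fin m → F} (hx : x ∈ L) (hu : u ∈ L) :
    dirDeriv f x u = 0 :=
  dirDeriv_eq_zero_of_line hf htq (hL u hu) fun s => hL _ (L.add_mem hx (L.smul_mem s hu))

theorem card_cosetZeros_le_aux {f : MvPolynomial (Fin m) F} {t k : ℕ}
    (hf : f.IsHomogeneous (t + 1)) (ht : 1 ≤ t) (htq : t + 1 ≤ Fintype.card F)
    {L : Submodule F (Fin m → F)} (hk : Module.finrank F L = k + 1)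
    (hL : ∀ v ∈ L, eval v f = 0) {e : Fin m → F} (he : ∃ u ∈ L, eval (e + u) f ≠ 0) :
    (cosetZeros f L e).card ≤ t * Fintype.card F ^ k ∧
    ((cosetZeros f L e).card = t * Fintype.card F ^ k →
      ∃ u ∈ L, ∀ w ∈ L, (linePoly f (e + w) u).coeff t ≠ 0) := by
  let b : Module.Basis (Fin (k + 1)) F L := Module.finBasisOfFinrankEq F L hk
  let b' : Fin (k + 1) → Fin m → F := fun j => (b j : Fin m → F)
  let φ : (Fin (k + 1) → F) → Fin m → F := fun y => ∑ j, y j • b' j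
  have hφ : ∀ y, φ y = ((b.equivFun.symm y : L) : Fin m → F) := fun y => by
    simp [φ, b', Module.Basis.equivFun_symm_apply]
  have hφL : ∀ y, φ y ∈ L := fun y => by rw [hφ]; exact Subtype.coe_prop _
  have hφs : ∀ u ∈ L, ∃ y, φ y = u := fun u hu => ⟨b.equivFun ⟨u, hu⟩, by simp [hφ]⟩
  have hφi : Function.Injective φ := fun y z h => by
    rw [hφ, hφ] at h
    exact b.equivFun.symm.injective (Subtype.ext h)
  set p := affPull f e b' with hp
  have hev : ∀ y, eval y p = eval (e + φ y) f := fun y => eval_affPull f e b' y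
  have hlp : ∀ y z, linePoly p y z = linePoly f (e + φ y) (φ z) := fun y z =>
    linePoly_affPull f e b' y z
  have hp0 : p ≠ 0 := fun h => by
    obtain ⟨u, hu, hne⟩ := he
    obtain ⟨y, rfl⟩ := hφs u hu
    exact hne (by rw [← hev, h]; simp)
  have hcard : (cosetZeros f L e).card = (Finset.univ.filter fun y => eval y p = 0).card := by
    symm
    refine Finset.card_bij (fun y _ => φ y) (fun y hy => ?_) (fun y _ z _ h => hφi h)
      (fun u hu => ?_)
    · rw [mem_cosetZeros]; exact ⟨hφL y, by rw [← hev]; simpa using hy⟩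
    · obtain ⟨hu1, hu2⟩ := mem_cosetZeros.1 hu
      obtain ⟨y, rfl⟩ := hφs u hu1
      exact ⟨y, by simpa [hev] using hu2, rfl⟩
  have hd1 : p.totalDegree ≤ t + 1 := (totalDegree_affPull_le f e b').trans hf.totalDegree_le
  have hd : p.totalDegree ≤ t := by
    refine totalDegree_le_of_homogeneousComponent_eq_zero hd1 ?_
    refine (homogeneousComponent_isHomogeneous (t + 1) p).eq_zero_of_forall_eval_eq_zero_of_le_card
      (fun y => ?_) (by rw [Cardinal.mk_fintype]; exact_mod_cast htq)
    rw [← coeff_linePoly hd1 0 y, hlp, coeff_linePoly_of_isHomogeneous hf, hL _ (hφL y)]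
  refine ⟨hcard ▸ card_zeros_le_mul_pow hp0 hd, fun heq => ?_⟩
  have hne : homogeneousComponent t p ≠ 0 := fun h0 => by
    obtain ⟨r, rfl⟩ : ∃ r, t = r + 1 := ⟨t - 1, by omega⟩
    have h1 := card_zeros_le_mul_pow hp0 (totalDegree_le_of_homogeneousComponent_eq_zero hd h0)
    rw [← hcard, heq, add_mul] at h1
    have : 0 < Fintype.card F ^ k := pow_pos Fintype.card_pos _
    omega
  obtain ⟨z, hz⟩ : ∃ z, eval z (homogeneousComponent t p) ≠ 0 := by
    by_contra! hall
    exact hne ((homogeneousComponent_isHomogeneous t p).eq_zero_of_forall_eval_eq_zero_of_le_card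
      hall (by rw [Cardinal.mk_fintype]; exact_mod_cast (by omega : t ≤ Fintype.card F)))
  refine ⟨φ z, hφL z, fun w hw => ?_⟩
  obtain ⟨y, rfl⟩ := hφs w hw
  rw [← hlp, coeff_linePoly hd]
  exact hz

end Coset

section CosetStructure

open MvPolynomial
open scoped Classical

theorem exists_sub_smul_mem_of_finrank {F V : Type*} [Field F] [AddCommGroup V] [Module F V]
    [FiniteDimensional F V] {k : ℕ} {M L : Submodule F V} (hML : M ≤ L)
    (hM : Module.finrank F M = k) (hL : Module.finrank F L = k + 1) {p : V} (hp : p ∈ L)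
    (hpM : p ∉ M) {x : V} (hx : x ∈ L) : ∃ r : F, x - r • p ∈ M := by
  have hle : M ⊔ Submodule.span F {p} ≤ L :=
    sup_le hML ((Submodule.span_singleton_le_iff_mem _ _).2 hp)
  have hlt : M < M ⊔ Submodule.span F {p} := by
    refine lt_of_le_of_ne le_sup_left fun h => hpM ?_
    rw [h]; exact Submodule.mem_sup_right (Submodule.mem_span_singleton_self p)
  have h1 := Submodule.finrank_lt_finrank_of_lt hlt
  have h2 := Submodule.eq_of_le_of_finrank_le hle (by omega)
  rw [← h2] at hx
  obtain ⟨y, hy, z, hz, rfl⟩ := Submodule.mem_sup.1 hx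
  obtain ⟨r, rfl⟩ := Submodule.mem_span_singleton.1 hz
  exact ⟨r, by simpa using hy⟩

variable {F : Type*} [Field F] [Fintype F] {m : ℕ}

theorem card_filter_add_smul {f : MvPolynomial (Fin m) F} {L : Submodule F (Fin m → F)}
    {e a : Fin m → F} (ha : a ∈ L) {c : F} (hc : c ≠ 0) :
    ((Finset.univ.filter fun u => u ∈ L).filter fun w => eval (e + (a + c • w)) f = 0).card =
      (cosetZeros f L e).card := by
  refine Finset.card_bij (fun w _ => a + c • w) (fun w hw => ?_) (fun w _ z _ h => ?_)
    (fun u hu => ?_)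
  · simp only [Finset.mem_filter, Finset.mem_univ, true_and] at hw
    exact mem_cosetZeros.2 ⟨L.add_mem ha (L.smul_mem c hw.1), hw.2⟩
  · exact smul_right_injective _ hc (add_left_cancel h)
  · obtain ⟨h1, h2⟩ := mem_cosetZeros.1 hu
    have h3 : a + c • (c⁻¹ • (u - a)) = u := by rw [smul_inv_smul₀ hc]; abel
    refine ⟨c⁻¹ • (u - a), ?_, h3⟩
    simp only [Finset.mem_filter, Finset.mem_univ, true_and]
    exact ⟨L.smul_mem _ (L.sub_mem h1 ha), by rw [h3]; exact h2⟩

section Tight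

variable {f : MvPolynomial (Fin m) F} {t k : ℕ} {L : Submodule F (Fin m → F)} {e : Fin m → F}

theorem exists_dirDeriv_ne_zero_of_tight
    (hf : f.IsHomogeneous (t + 1)) (ht : 1 ≤ t) (htq : t + 1 ≤ Fintype.card F)
    (hk : Module.finrank F L = k + 1) (hL : ∀ v ∈ L, eval v f = 0)
    (hT : (cosetZeros f L e).card = t * Fintype.card F ^ k) :
    ∃ u ∈ L, ∀ w ∈ L, eval (e + w) f = 0 → dirDeriv f (e + w) u ≠ 0 := by
  have hq : 0 < Fintype.card F := Fintype.card_pos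
  have he : ∃ u ∈ L, eval (e + u) f ≠ 0 := by
    by_contra! h
    have h1 : cosetZeros f L e = Finset.univ.filter fun u => u ∈ L := by
      ext u; simp only [mem_cosetZeros, Finset.mem_filter, Finset.mem_univ, true_and]
      exact ⟨fun h => h.1, fun hu => ⟨hu, h u hu⟩⟩
    rw [h1, card_filter_mem_submodule, hk, pow_succ, mul_comm] at hT
    have := Nat.eq_of_mul_eq_mul_right (pow_pos hq k) hT
    omega
  obtain ⟨u, hu, hco⟩ := (card_cosetZeros_le_aux hf ht htq hk hL he).2 hT
  refine ⟨u, hu, fun w hw hz hd => ?_⟩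
  have hne : ∀ w ∈ L, linePoly f (e + w) u ≠ 0 := fun w hw h => hco w hw (by rw [h]; simp)
  have hdeg : ∀ w, (linePoly f (e + w) u).natDegree ≤ t := fun w =>
    natDegree_linePoly_le_of_eval_eq_zero hf (hL u hu)
  set S := (Finset.univ.filter fun u => u ∈ L)
  have hle : ∀ w ∈ S, (Finset.univ.filter fun s => (linePoly f (e + w) u).eval s = 0).card ≤ t :=
    fun w hw => (card_zeros_le_natDegree (hne w (by simpa [S] using hw))).trans (hdeg w)
  have hsum : ∑ w ∈ S, (Finset.univ.filter fun s => (linePoly f (e + w) u).eval s = 0).card =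
      ∑ w ∈ S, t := by
    rw [Finset.sum_const, card_filter_mem_submodule, hk, smul_eq_mul]
    have h1 := Finset.sum_card_bipartiteAbove_eq_sum_card_bipartiteBelow (s := S)
      (t := (Finset.univ : Finset F)) fun w s => (linePoly f (e + w) u).eval s = 0
    have h2 : ∀ s : F, (Finset.bipartiteBelow (fun w s => (linePoly f (e + w) u).eval s = 0)
        S s).card = t * Fintype.card F ^ k := fun s => by
      rw [← hT, ← card_filter_add_smul (L.smul_mem s hu) one_ne_zero]
      congr 1
      ext w
      simp only [Finset.mem_bipartiteBelow, Finset.mem_filter, eval_linePoly, one_smul, S]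
      rw [add_assoc, add_comm w]
    simp only [h2, Finset.sum_const, Finset.card_univ, smul_eq_mul] at h1
    rw [Finset.sum_congr rfl fun w _ => rfl] at h1
    refine h1.trans ?_
    ring
  have h3 := (Finset.sum_eq_sum_iff_of_le hle).1 hsum w (by simpa [S] using hw)
  have h4 := card_zeros_lt_natDegree (hne w hw) (by rw [eval_linePoly]; simpa using hz)
    (by rw [eval_zero_derivative_linePoly, hd])
  have := hdeg w
  omega

theorem tangent_of_tight
    (hf : f.IsHomogeneous (t + 1)) (ht : 1 ≤ t) (htq : t + 1 ≤ Fintype.card F)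
    (hk : Module.finrank F L = k + 1) (hL : ∀ v ∈ L, eval v f = 0)
    (hT : (cosetZeros f L e).card = t * Fintype.card F ^ k) {w : Fin m → F} (hw : w ∈ L)
    (hz : eval (e + w) f = 0) :
    Module.finrank F ↥(L ⊓ LinearMap.ker (dirDeriv f (e + w))) = k ∧
    ∀ c ∈ L, dirDeriv f (e + w) c = 0 → eval (e + w + c) f = 0 := by
  have hq : 0 < Fintype.card F := Fintype.card_pos
  have hq1 : 1 < Fintype.card F := by omega
  set M := L ⊓ LinearMap.ker (dirDeriv f (e + w)) with hM
  set S := (Finset.univ.filter fun u => u ∈ L) with hS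
  set D := S.filter fun c => ∀ s : F, eval (e + w + s • c) f = 0 with hD
  have hmemS : ∀ c, c ∈ S ↔ c ∈ L := fun c => by simp [hS]
  have hScard : S.card = Fintype.card F ^ (k + 1) := by rw [card_filter_mem_submodule, hk]
  have hDM : ∀ c ∈ D, c ∈ M := fun c hc => by
    obtain ⟨h1, h2⟩ := Finset.mem_filter.1 hc
    rw [hmemS] at h1
    exact ⟨h1, dirDeriv_eq_zero_of_line hf htq (hL c h1) h2⟩
  have hub : ∀ c ∈ S, (Finset.univ.filter fun s : F => eval (e + w + s • c) f = 0).card ≤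
      if c ∈ D then Fintype.card F else t := fun c hc => by
    split_ifs with h
    · exact (Finset.card_filter_le _ _).trans (by rw [Finset.card_univ])
    · have hne : linePoly f (e + w) c ≠ 0 := fun h0 => h (Finset.mem_filter.2 ⟨hc, fun s => by
        rw [← eval_linePoly, h0]; simp⟩)
      have h1 := card_zeros_le_natDegree hne
      have h2 := natDegree_linePoly_le_of_eval_eq_zero (x := e + w) hf (hL c ((hmemS c).1 hc))
      simp only [eval_linePoly] at h1
      exact h1.trans h2
  have hsum : ∑ c ∈ S, (Finset.univ.filter fun s : F => eval (e + w + s • c) f = 0).card =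
      Fintype.card F ^ (k + 1) + (Fintype.card F - 1) * (t * Fintype.card F ^ k) := by
    have h1 := Finset.sum_card_bipartiteAbove_eq_sum_card_bipartiteBelow (s := S)
      (t := (Finset.univ : Finset F)) fun c s => eval (e + w + s • c) f = 0
    refine h1.trans ?_
    rw [← Finset.add_sum_erase _ _ (Finset.mem_univ (0 : F))]
    congr 1
    · rw [← hScard]
      congr 1
      ext c
      simp [Finset.mem_bipartiteBelow, hz]
    · rw [Finset.sum_congr rfl (g := fun _ => t * Fintype.card F ^ k), Finset.sum_const,
        Finset.card_erase_of_mem (Finset.mem_univ _), Finset.card_univ, smul_eq_mul]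
      intro s hs
      rw [← hT, ← card_filter_add_smul hw (Finset.ne_of_mem_erase hs)]
      congr 1
      ext c
      simp only [Finset.mem_bipartiteBelow, Finset.mem_filter, add_assoc, hS]
  have hDS : D ⊆ S := Finset.filter_subset _ _
  have hDcard : Fintype.card F ^ k ≤ D.card := by
    have h1 := Finset.sum_le_sum hub
    rw [hsum, Finset.sum_ite, Finset.sum_const, Finset.sum_const, smul_eq_mul, smul_eq_mul,
      Finset.filter_mem_eq_inter, Finset.inter_eq_right.2 hDS] at h1
    have h2 := Finset.card_filter_add_card_filter_not (s := S) (fun c => c ∈ D)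
    rw [Finset.filter_mem_eq_inter, Finset.inter_eq_right.2 hDS, hScard] at h2
    obtain ⟨r, hr⟩ : ∃ r, Fintype.card F = t + r + 1 := ⟨Fintype.card F - t - 1, by omega⟩
    rw [pow_succ, hr] at h1 h2
    rw [hr]
    set A := (t + r + 1) ^ k
    set n := (S.filter fun c => c ∉ D).card
    have h3 : t + r + 1 - 1 = t + r := rfl
    rw [h3] at h1
    by_contra! hlt
    nlinarith
  have hMfin : Module.finrank F M < k + 1 := by
    rw [← hk]
    refine Submodule.finrank_lt_finrank_of_lt (lt_of_le_of_ne inf_le_left fun h => ?_)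
    obtain ⟨u, hu, hne⟩ := exists_dirDeriv_ne_zero_of_tight hf ht htq hk hL hT
    have : u ∈ M := by rw [h]; exact hu
    exact hne w hw hz this.2
  have hMc := card_filter_mem_submodule M
  have hDM' : D ⊆ Finset.univ.filter fun u => u ∈ M := fun c hc => by simpa using hDM c hc
  have hDle := Finset.card_le_card hDM'
  rw [hMc] at hDle
  have hfin : Module.finrank F M = k := by
    have := (Nat.pow_le_pow_iff_right hq1).1 (hDcard.trans hDle)
    omega
  rw [hfin] at hMc
  have hEq := Finset.eq_of_subset_of_card_le hDM' (by rw [hMc]; exact hDcard)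
  refine ⟨hfin, fun c hc hdc => ?_⟩
  have : c ∈ D := by
    rw [hEq]; simp only [Finset.mem_filter, Finset.mem_univ, true_and]; exact ⟨hc, hdc⟩
  simpa using (Finset.mem_filter.1 this).2 1

theorem coset_structure
    (hf : f.IsHomogeneous (t + 1)) (ht : 1 ≤ t) (htq : t + 1 ≤ Fintype.card F)
    (hk : Module.finrank F L = k + 1) (hL : ∀ v ∈ L, eval v f = 0)
    (hT : (cosetZeros f L e).card = t * Fintype.card F ^ k) :
    ∃ M ≤ L, Module.finrank F M = k ∧
      (∀ w ∈ L, eval (e + w) f = 0 → ∀ c ∈ M, eval (e + w + c) f = 0) ∧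
      ∀ p ∈ L, dirDeriv f p e = 0 ↔ p ∈ M := by
  have hq : 0 < Fintype.card F := Fintype.card_pos
  let M : (Fin m → F) → Submodule F (Fin m → F) := fun w => L ⊓ LinearMap.ker (dirDeriv f (e + w))
  have hfin : ∀ w ∈ L, eval (e + w) f = 0 → Module.finrank F (M w) = k := fun w hw hz =>
    (tangent_of_tight hf ht htq hk hL hT hw hz).1
  have hz' : ∀ w ∈ L, eval (e + w) f = 0 → ∀ c ∈ M w, eval (e + w + c) f = 0 :=
    fun w hw hz c hc => (tangent_of_tight hf ht htq hk hL hT hw hz).2 c hc.1 hc.2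
  have htrans : ∀ w ∈ L, eval (e + w) f = 0 → ∀ a ∈ M w, M (w + a) = M w := by
    intro w hw hz a ha
    have hz2 : eval (e + (w + a)) f = 0 := by rw [← add_assoc]; exact hz' w hw hz a ha
    have hle : M w ≤ M (w + a) := fun c hc => ⟨hc.1, by
      refine dirDeriv_eq_zero_of_line hf htq (hL c hc.1) fun s => ?_
      have := hz' w hw hz (a + s • c) ((M w).add_mem ha ((M w).smul_mem s hc))
      rw [← this, ← add_assoc, ← add_assoc]⟩
    refine (Submodule.eq_of_le_of_finrank_le hle ?_).symm
    rw [hfin w hw hz, hfin _ (L.add_mem hw ha.1) hz2]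
  have hconst : ∀ w ∈ L, eval (e + w) f = 0 → ∀ w' ∈ L, eval (e + w') f = 0 → M w = M w' := by
    intro w hw hz w' hw' hz'
    by_contra hne
    have hle : ¬ M w' ≤ M w := fun h => hne
      (Submodule.eq_of_le_of_finrank_le h (by rw [hfin w hw hz, hfin w' hw' hz'])).symm
    obtain ⟨b, hb, hbM⟩ := SetLike.not_le_iff_exists.1 hle
    obtain ⟨r, hr⟩ := exists_sub_smul_mem_of_finrank (inf_le_left : M w ≤ L) (hfin w hw hz) hk
      hb.1 hbM (L.sub_mem hw' hw)
    have h1 := htrans w hw hz _ hr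
    have h2 := htrans w' hw' hz' (-(r • b)) ((M w').neg_mem ((M w').smul_mem r hb))
    apply hne
    rw [← h1, ← h2]
    congr 1
    abel
  obtain ⟨w, hwz⟩ : (cosetZeros f L e).Nonempty := by
    rw [← Finset.card_pos, hT]; positivity
  obtain ⟨hw, hz⟩ := mem_cosetZeros.1 hwz
  have hinv : ∀ w' ∈ L, eval (e + w') f = 0 → ∀ c ∈ M w, eval (e + w' + c) f = 0 :=
    fun w' hw' hz1 c hc => hz' w' hw' hz1 c (by rwa [hconst w' hw' hz1 w hw hz])
  refine ⟨M w, inf_le_left, hfin w hw hz, hinv, fun p hp => ⟨fun hpe => ?_, fun hpM => ?_⟩⟩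
  · by_contra hpM
    obtain ⟨w1, hw1, hne⟩ : ∃ u ∈ L, eval (e + u) f ≠ 0 := by
      by_contra! h
      have h1 : cosetZeros f L e = Finset.univ.filter fun u => u ∈ L := by
        ext u; simp only [mem_cosetZeros, Finset.mem_filter, Finset.mem_univ, true_and]
        exact ⟨fun h => h.1, fun hu => ⟨hu, h u hu⟩⟩
      rw [h1, card_filter_mem_submodule, hk, pow_succ, mul_comm] at hT
      have := Nat.eq_of_mul_eq_mul_right (pow_pos hq k) hT
      omega
    set R := Finset.univ.filter fun r : F => eval (e + w1 + r • p) f = 0 with hR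
    have hRcard : t ≤ R.card := by
      have hsub : cosetZeros f L e ⊆
          ((Finset.univ.filter fun u => u ∈ M w) ×ˢ R).image fun x => w1 + x.2 • p + x.1 := by
        intro u hu
        obtain ⟨hu1, hu2⟩ := mem_cosetZeros.1 hu
        obtain ⟨r, hr⟩ := exists_sub_smul_mem_of_finrank (inf_le_left : M w ≤ L) (hfin w hw hz) hk
          hp hpM (L.sub_mem hu1 hw1)
        refine Finset.mem_image.2 ⟨(u - w1 - r • p, r), ?_, by simp⟩
        simp only [Finset.mem_product, Finset.mem_filter, Finset.mem_univ, true_and, hR]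
        refine ⟨hr, ?_⟩
        have := hinv u hu1 hu2 _ ((M w).neg_mem hr)
        rwa [show e + u + -(u - w1 - r • p) = e + w1 + r • p by abel] at this
      have h1 := (Finset.card_le_card hsub).trans Finset.card_image_le
      rw [hT, Finset.card_product, card_filter_mem_submodule, hfin w hw hz, mul_comm] at h1
      exact Nat.le_of_mul_le_mul_left h1 (pow_pos hq k)
    have hlc := coeff_linePoly_of_isHomogeneous hf p (e + w1)
    have hne0 : linePoly f p (e + w1) ≠ 0 := fun h0 => hne (by rw [← hlc, h0]; simp)
    have hd0 : dirDeriv f p (e + w1) = 0 := by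
      rw [map_add, hpe, dirDeriv_eq_zero_of_mem hf htq hL hp hw1, add_zero]
    have h1 := card_zeros_lt_natDegree hne0 (by rw [eval_linePoly]; simpa using hL p hp)
      (by rw [eval_zero_derivative_linePoly, hd0])
    have h2 := (natDegree_linePoly_le f p (e + w1)).trans hf.totalDegree_le
    have h3 : insert 0 (R.image fun r => r⁻¹) ⊆
        Finset.univ.filter fun s => (linePoly f p (e + w1)).eval s = 0 := by
      intro s hs
      rw [Finset.mem_filter, eval_linePoly]
      refine ⟨Finset.mem_univ _, ?_⟩
      rcases Finset.mem_insert.1 hs with rfl | hs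
      · simpa using hL p hp
      · obtain ⟨r, hr, rfl⟩ := Finset.mem_image.1 hs
        have hr' : eval (e + w1 + r • p) f = 0 := by simpa [hR] using hr
        have hr0 : r ≠ 0 := fun h => hne (by simpa [h] using hr')
        have : p + r⁻¹ • (e + w1) = r⁻¹ • (e + w1 + r • p) := by
          rw [smul_add r⁻¹ (e + w1), inv_smul_smul₀ hr0, add_comm]
        rw [this, eval_smul_of_isHomogeneous hf, hr', mul_zero]
    have h4 := Finset.card_le_card h3
    rw [Finset.card_insert_of_notMem, Finset.card_image_of_injective _ inv_injective] at h4
    · omega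
    · intro h0
      obtain ⟨r, hr, h0⟩ := Finset.mem_image.1 h0
      rw [inv_eq_zero] at h0
      subst h0
      exact hne (by simpa [hR] using hr)
  · have hline : ∀ s : F, eval (p + s • (e + w)) f = 0 := fun s => by
      by_cases hs : s = 0
      · subst hs; simpa using hL p hp
      · have : p + s • (e + w) = s • (e + w + s⁻¹ • p) := by
          rw [smul_add s (e + w), smul_inv_smul₀ hs, add_comm]
        rw [this, eval_smul_of_isHomogeneous hf, hinv w hw hz _ ((M w).smul_mem _ hpM), mul_zero]
    have h1 := dirDeriv_eq_zero_of_line hf htq hz hline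
    rwa [map_add, dirDeriv_eq_zero_of_mem hf htq hL hp hw, add_zero] at h1

end Tight

end CosetStructure

section Tightness

open MvPolynomial
open scoped Classical

variable {F : Type*} [Field F] [Fintype F] {m : ℕ}
  {f : MvPolynomial (Fin m) F} {t k : ℕ} {L : Submodule F (Fin m → F)}

theorem finrank_sup_span_singleton {F V : Type*} [Field F] [AddCommGroup V] [Module F V]
    [FiniteDimensional F V] {L : Submodule F V} {e : V} (he : e ∉ L) :
    Module.finrank F ↥(L ⊔ Submodule.span F {e}) = Module.finrank F L + 1 := by
  have hlt : L < L ⊔ Submodule.span F {e} := by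
    refine lt_of_le_of_ne le_sup_left fun h => he ?_
    rw [h]; exact Submodule.mem_sup_right (Submodule.mem_span_singleton_self e)
  have h1 := Submodule.finrank_lt_finrank_of_lt hlt
  have h2 := Submodule.finrank_add_le_finrank_add_finrank L (Submodule.span F {e})
  have h3 := finrank_span_singleton (K := F) (v := e) fun h => he (h ▸ L.zero_mem)
  omega

theorem card_cosetZeros_le (hf : f.IsHomogeneous (t + 1)) (ht : 1 ≤ t)
    (htq : t + 1 ≤ Fintype.card F) (hk : Module.finrank F L = k + 1)
    (hL : ∀ v ∈ L, eval v f = 0)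
    (hbig : ∀ U : Submodule F (Fin m → F), Module.finrank F U = k + 2 → ¬ ∀ v ∈ U, eval v f = 0)
    {e : Fin m → F} (he : e ∉ L) : (cosetZeros f L e).card ≤ t * Fintype.card F ^ k := by
  refine (card_cosetZeros_le_aux hf ht htq hk hL ?_).1
  by_contra! h
  refine hbig (L ⊔ Submodule.span F {e}) (by rw [finrank_sup_span_singleton he, hk]) fun v hv => ?_
  obtain ⟨w, hw, z, hz, rfl⟩ := Submodule.mem_sup.1 hv
  obtain ⟨s, rfl⟩ := Submodule.mem_span_singleton.1 hz
  by_cases hs : s = 0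
  · subst hs; simpa using hL w hw
  · have : w + s • e = s • (e + s⁻¹ • w) := by rw [smul_add, smul_inv_smul₀ hs, add_comm]
    rw [this, eval_smul_of_isHomogeneous hf, h _ (L.smul_mem _ hw), mul_zero]

theorem sum_card_cosetZeros (f : MvPolynomial (Fin m) F) (L : Submodule F (Fin m → F)) :
    ∑ e with e ∉ L, (cosetZeros f L e).card =
      Fintype.card F ^ Module.finrank F L *
        (Finset.univ.filter fun v => v ∉ L ∧ eval v f = 0).card := by
  rw [← card_filter_mem_submodule, ← Finset.card_product, ← Finset.card_sigma]
  refine Finset.card_bij' (fun x _ => (x.2, x.1 + x.2)) (fun y _ => ⟨y.2 - y.1, y.1⟩)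
    (fun x hx => ?_) (fun y hy => ?_) (fun x hx => ?_) (fun y hy => ?_)
  · simp only [Finset.mem_sigma, Finset.mem_filter, Finset.mem_univ, true_and, mem_cosetZeros,
      Finset.mem_product] at hx ⊢
    exact ⟨hx.2.1, fun h => hx.1 (by simpa using L.sub_mem h hx.2.1), hx.2.2⟩
  · simp only [Finset.mem_sigma, Finset.mem_filter, Finset.mem_univ, true_and, mem_cosetZeros,
      Finset.mem_product] at hy ⊢
    exact ⟨fun h => hy.2.1 (by simpa using L.add_mem h hy.1), hy.1, by simpa using hy.2.2⟩
  · simp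
  · simp

theorem card_filter_notMem_submodule (L : Submodule F (Fin m → F)) :
    (Finset.univ.filter fun u => u ∉ L).card =
      Fintype.card F ^ m - Fintype.card F ^ Module.finrank F L := by
  have h1 := Finset.card_filter_add_card_filter_not (s := Finset.univ) (fun u => u ∈ L)
  rw [card_filter_mem_submodule, Finset.card_univ, Fintype.card_fun, Fintype.card_fin] at h1
  omega

theorem tight_iff_card (hf : f.IsHomogeneous (t + 1)) (ht : 1 ≤ t)
    (htq : t + 1 ≤ Fintype.card F) (hk : Module.finrank F L = k + 1)
    (hL : ∀ v ∈ L, eval v f = 0)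
    (hbig : ∀ U : Submodule F (Fin m → F), Module.finrank F U = k + 2 → ¬ ∀ v ∈ U, eval v f = 0) :
    (∀ e ∉ L, (cosetZeros f L e).card = t * Fintype.card F ^ k) ↔
      Fintype.card F ^ (k + 1) * (Finset.univ.filter fun v => v ∉ L ∧ eval v f = 0).card =
        (Fintype.card F ^ m - Fintype.card F ^ (k + 1)) * (t * Fintype.card F ^ k) := by
  have h1 := sum_card_cosetZeros f L
  have h2 := Finset.sum_eq_sum_iff_of_le (s := Finset.univ.filter fun e => e ∉ L)
    (f := fun e => (cosetZeros f L e).card) (g := fun _ => t * Fintype.card F ^ k) fun e he =>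
      card_cosetZeros_le hf ht htq hk hL hbig (by simpa using he)
  rw [Finset.sum_const, smul_eq_mul, card_filter_notMem_submodule, h1, hk] at h2
  rw [h2]
  simp

theorem card_nonzero_zeros (hf : f.IsHomogeneous (t + 1)) :
    (Finset.univ.filter fun v => v ≠ 0 ∧ eval v f = 0).card =
      numPoints f * (Fintype.card F - 1) := by
  have : Fintype (Projectivization F (Fin m → F)) := Fintype.ofFinite _
  rw [numPoints, Nat.card_eq_fintype_card, Fintype.card_subtype, ← Fintype.card_units,
    ← Finset.card_univ (α := Fˣ), ← Finset.card_product]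
  symm
  refine Finset.card_bij (fun x _ => x.2 • x.1.rep) (fun x hx => ?_) (fun x _ y _ h => ?_)
    (fun v hv => ?_)
  · simp only [Finset.mem_product, Finset.mem_filter, Finset.mem_univ, true_and, and_true] at hx ⊢
    refine ⟨(smul_ne_zero_iff_ne _).2 x.1.rep_nonzero, ?_⟩
    rw [Units.smul_def, eval_smul_of_isHomogeneous hf, hx, mul_zero]
  · obtain ⟨p, c⟩ := x
    obtain ⟨p', c'⟩ := y
    dsimp only at h
    have hp : p = p' := by
      rw [← p.mk_rep, ← p'.mk_rep, Projectivization.mk_eq_mk_iff]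
      exact ⟨c⁻¹ * c', by rw [mul_smul, ← h, inv_smul_smul]⟩
    subst hp
    rw [Units.smul_def, Units.smul_def] at h
    exact Prod.ext rfl (Units.ext (smul_left_injective F p.rep_nonzero h))
  · obtain ⟨h0, hv⟩ := (Finset.mem_filter.1 hv).2
    obtain ⟨a, ha⟩ := Projectivization.exists_smul_eq_mk_rep F v h0
    refine ⟨(Projectivization.mk F v h0, a⁻¹), ?_, by simp [← ha]⟩
    simp only [Finset.mem_product, Finset.mem_filter, Finset.mem_univ, true_and, and_true]
    rw [← ha, Units.smul_def, eval_smul_of_isHomogeneous hf, hv, mul_zero]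

theorem card_filter_zeros_eq (hL : ∀ v ∈ L, eval v f = 0) :
    (Finset.univ.filter fun v => eval v f = 0).card =
      (Finset.univ.filter fun v => v ∉ L ∧ eval v f = 0).card +
        Fintype.card F ^ Module.finrank F L := by
  rw [← card_filter_mem_submodule,
    ← Finset.card_filter_add_card_filter_not (s := Finset.univ.filter fun v => eval v f = 0)
    (fun v => v ∈ L), Finset.filter_filter, Finset.filter_filter, add_comm]
  congr 2
  · ext v; simp only [Finset.mem_filter, Finset.mem_univ, true_and]; tauto
  · ext v; simp only [Finset.mem_filter, Finset.mem_univ, true_and]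
    exact ⟨fun h => h.2, fun h => ⟨hL v h, h⟩⟩

theorem NP_mul_pred (q N : ℕ) (hq : 1 ≤ q) : NP q N * (q - 1) + 1 = q ^ (N + 1) := by
  obtain ⟨r, rfl⟩ : ∃ r, q = r + 1 := ⟨q - 1, by omega⟩
  rw [NP, Nat.add_sub_cancel, geom_sum_mul_add]

theorem tight_of_numPoints {n : ℕ} {f : MvPolynomial (Fin (n + 2)) F}
    {L : Submodule F (Fin (n + 2) → F)} (hf : f.IsHomogeneous (t + 1)) (ht : 1 ≤ t)
    (htq : t + 1 ≤ Fintype.card F) (hk : Module.finrank F L = k + 1) (hkn : k ≤ n)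
    (hL : ∀ v ∈ L, eval v f = 0)
    (hbig : ∀ U : Submodule F (Fin (n + 2) → F), Module.finrank F U = k + 2 →
      ¬ ∀ v ∈ U, eval v f = 0)
    (heq : numPoints f = Theta (Fintype.card F) (t + 1) n k) {e : Fin (n + 2) → F} (he : e ∉ L) :
    (cosetZeros f L e).card = t * Fintype.card F ^ k := by
  refine (tight_iff_card hf ht htq hk hL hbig).2 ?_ e he
  have hq : 1 ≤ Fintype.card F := Fintype.card_pos
  have h1 := card_nonzero_zeros hf
  have h2 := card_filter_zeros_eq hL
  have h3 := card_filter_zeros_eq (f := f) (L := ⊥) fun v hv => by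
    rw [(Submodule.mem_bot F).1 hv, ← zero_smul F (0 : Fin (n + 2) → F),
      eval_smul_of_isHomogeneous hf]; simp
  simp only [Submodule.mem_bot, finrank_bot, pow_zero] at h3
  have h4 := NP_mul_pred (Fintype.card F) (n - k) hq
  have h5 := NP_mul_pred (Fintype.card F) k hq
  rw [h1, heq, Theta, h2, hk, ← h5, Nat.add_sub_cancel, add_mul, mul_assoc] at h3
  have h6 : Fintype.card F ^ (n + 2) =
      Fintype.card F ^ (k + 1) * (NP (Fintype.card F) (n - k) * (Fintype.card F - 1) + 1) := by
    rw [h4, ← pow_add]; congr 1; omega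
  have h7 : (Finset.univ.filter fun v => v ∉ L ∧ eval v f = 0).card =
      t * Fintype.card F ^ k * (NP (Fintype.card F) (n - k) * (Fintype.card F - 1)) := by omega
  rw [h6, h7, mul_add, mul_one, Nat.add_sub_cancel]
  ring

end Tightness

section Surface

open MvPolynomial
open scoped Classical

variable {F : Type*} [Field F]

/-- `ℓ` is a line of `P³` contained in the surface `f = 0`. -/
def IsXLine (f : MvPolynomial (Fin 4) F) (ℓ : Submodule F (Fin 4 → F)) : Prop :=
  Module.finrank F ℓ = 2 ∧ ∀ v ∈ ℓ, eval v f = 0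

theorem eq_span_singleton_of_finrank_one {V : Type*} [AddCommGroup V] [Module F V]
    {M : Submodule F V} (hM : Module.finrank F M = 1) {p : V} (hp : p ∈ M) (hp0 : p ≠ 0) :
    M = Submodule.span F {p} := by
  have : FiniteDimensional F M := FiniteDimensional.of_finrank_pos (by omega)
  refine (Submodule.eq_of_le_of_finrank_eq
    ((Submodule.span_singleton_le_iff_mem _ _).2 hp) ?_).symm
  rw [finrank_span_singleton hp0, hM]

variable [Fintype F]

/-- A surface of degree `t + 1 ≤ q` containing a line but no plane, such that each plane through
a line of the surface has the largest possible number of points. -/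
structure IsTightSurface (f : MvPolynomial (Fin 4) F) (t : ℕ) : Prop where
  hom : f.IsHomogeneous (t + 1)
  one_le : 1 ≤ t
  lt_card : t + 1 ≤ Fintype.card F
  exists_line : ∃ ℓ, IsXLine f ℓ
  no_plane : ∀ U : Submodule F (Fin 4 → F), Module.finrank F U = 3 → ¬ ∀ v ∈ U, eval v f = 0
  tight : ∀ ℓ, IsXLine f ℓ → ∀ e ∉ ℓ, (cosetZeros f ℓ e).card = t * Fintype.card F

namespace IsTightSurface

variable {f : MvPolynomial (Fin 4) F} {t : ℕ} {ℓ m : Submodule F (Fin 4 → F)}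
  {e p x : Fin 4 → F}

theorem eval_smul (hS : IsTightSurface f t) (hx : eval x f = 0) (r : F) :
    eval (r • x) f = 0 := by
  rw [eval_smul_of_isHomogeneous hS.hom, hx, mul_zero]

theorem structure_of_notMem (hS : IsTightSurface f t) (hℓ : IsXLine f ℓ) (he : e ∉ ℓ) :
    ∃ M ≤ ℓ, Module.finrank F M = 1 ∧
      (∀ w ∈ ℓ, eval (e + w) f = 0 → ∀ c ∈ M, eval (e + w + c) f = 0) ∧
      ∀ p ∈ ℓ, dirDeriv f p e = 0 ↔ p ∈ M :=
  coset_structure hS.hom hS.one_le hS.lt_card hℓ.1 hℓ.2 (by rw [hS.tight ℓ hℓ e he, pow_one])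

theorem isXLine_of_forall (hS : IsTightSurface f t) (hp : eval p f = 0) (hp0 : p ≠ 0)
    (hx : x ∉ Submodule.span F {p}) (h : ∀ r : F, eval (x + r • p) f = 0) :
    IsXLine f (Submodule.span F {p} ⊔ Submodule.span F {x}) := by
  refine ⟨by rw [finrank_sup_span_singleton hx, finrank_span_singleton hp0], fun v hv => ?_⟩
  obtain ⟨y, hy, z, hz, rfl⟩ := Submodule.mem_sup.1 hv
  obtain ⟨r, rfl⟩ := Submodule.mem_span_singleton.1 hy
  obtain ⟨s, rfl⟩ := Submodule.mem_span_singleton.1 hz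
  by_cases hs : s = 0
  · subst hs; simpa using hS.eval_smul hp r
  · have : r • p + s • x = s • (x + (s⁻¹ * r) • p) := by
      rw [smul_add, smul_smul, mul_inv_cancel_left₀ hs, add_comm]
    rw [this]; exact hS.eval_smul (h _) s

theorem dirDeriv_eq_zero (hS : IsTightSurface f t) (hℓ : IsXLine f ℓ) (hp : p ∈ ℓ)
    (hx : x ∈ ℓ) : dirDeriv f p x = 0 :=
  dirDeriv_eq_zero_of_mem hS.hom hS.lt_card hℓ.2 hp hx

theorem existsUnique_line_meeting (hS : IsTightSurface f t) (hℓ : IsXLine f ℓ)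
    (hp : eval p f = 0) (hpℓ : p ∉ ℓ) :
    ∃! m, IsXLine f m ∧ p ∈ m ∧ m ⊓ ℓ ≠ ⊥ := by
  obtain ⟨M, hMℓ, hM1, hinv, hD⟩ := hS.structure_of_notMem hℓ hpℓ
  obtain ⟨c, hcM, hc0⟩ : ∃ c ∈ M, c ≠ 0 := by
    refine (Submodule.ne_bot_iff M).1 fun h => ?_
    rw [h, finrank_bot] at hM1; omega
  have hMc := eq_span_singleton_of_finrank_one hM1 hcM hc0
  have hpc : p ∉ Submodule.span F {c} := fun h => hpℓ (hMℓ (hMc ▸ h))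
  have hline : IsXLine f (Submodule.span F {c} ⊔ Submodule.span F {p}) :=
    hS.isXLine_of_forall (hℓ.2 c (hMℓ hcM)) hc0 hpc fun r => by
      have := hinv 0 ℓ.zero_mem (by simpa using hp) (r • c) (M.smul_mem r hcM)
      simpa using this
  refine ⟨_, ⟨hline, Submodule.mem_sup_right (Submodule.mem_span_singleton_self p), ?_⟩, ?_⟩
  · exact (Submodule.ne_bot_iff _).2 ⟨c, ⟨Submodule.mem_sup_left
      (Submodule.mem_span_singleton_self c), hMℓ hcM⟩, hc0⟩
  · rintro m ⟨hm, hpm, hmℓ⟩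
    obtain ⟨r, ⟨hrm, hrℓ⟩, hr0⟩ := (Submodule.ne_bot_iff _).1 hmℓ
    have hrM : r ∈ M := (hD r hrℓ).1 (hS.dirDeriv_eq_zero hm hrm hpm)
    have hcm : M ≤ m := by
      rw [eq_span_singleton_of_finrank_one hM1 hrM hr0]
      exact (Submodule.span_singleton_le_iff_mem _ _).2 hrm
    refine (Submodule.eq_of_le_of_finrank_eq (sup_le (hMc ▸ hcm)
      ((Submodule.span_singleton_le_iff_mem _ _).2 hpm)) ?_).symm
    rw [hline.1, hm.1]

theorem exists_line_through (hS : IsTightSurface f t) (hp : eval p f = 0) :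
    ∃ m, IsXLine f m ∧ p ∈ m := by
  obtain ⟨ℓ, hℓ⟩ := hS.exists_line
  by_cases hpℓ : p ∈ ℓ
  · exact ⟨ℓ, hℓ, hpℓ⟩
  · obtain ⟨m, hm, -⟩ := hS.existsUnique_line_meeting hℓ hp hpℓ
    exact ⟨m, hm.1, hm.2.1⟩

theorem finrank_ker_dirDeriv (hS : IsTightSurface f t) (hp : eval p f = 0) (hp0 : p ≠ 0) :
    Module.finrank F (LinearMap.ker (dirDeriv f p)) = 3 := by
  obtain ⟨ℓ, hℓ, hpℓ⟩ := hS.exists_line_through hp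
  have hrange : ∀ y, Module.finrank F (LinearMap.ker (dirDeriv f y)) +
      Module.finrank F (LinearMap.range (dirDeriv f y)) = 4 := fun y => by
    have := LinearMap.finrank_range_add_finrank_ker (dirDeriv f y)
    rw [Module.finrank_fin_fun] at this
    omega
  have hle : ∀ y, Module.finrank F (LinearMap.range (dirDeriv f y)) ≤ 1 := fun y => by
    have := Submodule.finrank_le (LinearMap.range (dirDeriv f y))
    rwa [Module.finrank_self] at this
  have hne : dirDeriv f p ≠ 0 := fun h0 => by
    obtain ⟨p', hp'ℓ, hp'⟩ : ∃ p' ∈ ℓ, p' ∉ Submodule.span F {p} := by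
      refine SetLike.not_le_iff_exists.1 fun h => ?_
      have := Submodule.finrank_mono h
      rw [hℓ.1, finrank_span_singleton hp0] at this
      omega
    obtain ⟨e, heD, he⟩ : ∃ e ∈ LinearMap.ker (dirDeriv f p'), e ∉ ℓ := by
      refine SetLike.not_le_iff_exists.1 fun h => ?_
      have := Submodule.finrank_mono h
      have h1 := hrange p'
      have h2 := hle p'
      rw [hℓ.1] at this
      omega
    obtain ⟨M, hMℓ, hM1, -, hD⟩ := hS.structure_of_notMem hℓ he
    have h1 : p ∈ M := (hD p hpℓ).1 (by rw [h0]; rfl)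
    have h2 : p' ∈ M := (hD p' hp'ℓ).1 heD
    exact hp' (eq_span_singleton_of_finrank_one hM1 h1 hp0 ▸ h2)
  have h1 : LinearMap.range (dirDeriv f p) ≠ ⊥ := fun h => hne (LinearMap.range_eq_bot.1 h)
  have h2 := Submodule.one_le_finrank_iff.2 h1
  have h3 := hrange p
  have h4 := hle p
  omega

theorem eval_add_smul_of_dirDeriv_eq_zero (hS : IsTightSurface f t) (hp : eval p f = 0)
    (hx : eval x f = 0) (h : dirDeriv f p x = 0) (r : F) : eval (x + r • p) f = 0 := by
  obtain ⟨ℓ, hℓ, hpℓ⟩ := hS.exists_line_through hp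
  by_cases hxℓ : x ∈ ℓ
  · exact hℓ.2 _ (ℓ.add_mem hxℓ (ℓ.smul_mem r hpℓ))
  · obtain ⟨M, hMℓ, hM1, hinv, hD⟩ := hS.structure_of_notMem hℓ hxℓ
    have := hinv 0 ℓ.zero_mem (by simpa using hx) (r • p) (M.smul_mem r ((hD p hpℓ).1 h))
    simpa using this

theorem isXLine_of_dirDeriv_eq_zero (hS : IsTightSurface f t) (hp : eval p f = 0) (hp0 : p ≠ 0)
    (hx : eval x f = 0) (hxp : x ∉ Submodule.span F {p}) (h : dirDeriv f p x = 0) :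
    IsXLine f (Submodule.span F {p} ⊔ Submodule.span F {x}) :=
  hS.isXLine_of_forall hp hp0 hxp (hS.eval_add_smul_of_dirDeriv_eq_zero hp hx h)

theorem card_tangent_plane_zeros (hS : IsTightSurface f t) (hp : eval p f = 0) (hp0 : p ≠ 0) :
    (Finset.univ.filter fun v => dirDeriv f p v = 0 ∧ eval v f = 0).card =
      Fintype.card F ^ 2 + (Fintype.card F - 1) * (t * Fintype.card F) := by
  obtain ⟨ℓ, hℓ, hpℓ⟩ := hS.exists_line_through hp
  have hker := hS.finrank_ker_dirDeriv hp hp0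
  have hℓker : ℓ ≤ LinearMap.ker (dirDeriv f p) := fun v hv => hS.dirDeriv_eq_zero hℓ hpℓ hv
  obtain ⟨e, heD, he⟩ : ∃ e ∈ LinearMap.ker (dirDeriv f p), e ∉ ℓ := by
    refine SetLike.not_le_iff_exists.1 fun h => ?_
    have := Submodule.finrank_mono h
    rw [hℓ.1] at this
    omega
  rw [← Finset.card_filter_add_card_filter_not (fun v => v ∈ ℓ), Finset.filter_filter,
    Finset.filter_filter]
  congr 1
  · rw [← hℓ.1, ← card_filter_mem_submodule]
    congr 1
    ext v
    simp only [Finset.mem_filter, Finset.mem_univ, true_and]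
    exact ⟨fun h => h.2, fun h => ⟨⟨hℓker h, hℓ.2 v h⟩, h⟩⟩
  · rw [← hS.tight ℓ hℓ e he, ← Fintype.card_units, ← Finset.card_univ (α := Fˣ),
      ← Finset.card_product]
    symm
    refine Finset.card_bij (fun x _ => x.1 • (e + x.2)) (fun x hx => ?_) (fun x hx y hy h => ?_)
      (fun v hv => ?_)
    · simp only [Finset.mem_product, Finset.mem_filter, Finset.mem_univ, true_and,
        mem_cosetZeros] at hx ⊢
      refine ⟨⟨?_, hS.eval_smul hx.2 _⟩, fun h => he ?_⟩
      · rw [Units.smul_def, map_smul, map_add, LinearMap.mem_ker.1 heD,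
          LinearMap.mem_ker.1 (hℓker hx.1)]
        simp
      · have h2 := ℓ.smul_mem (x.1⁻¹ : Fˣ).1 h
        rw [← Units.smul_def, inv_smul_smul] at h2
        simpa using ℓ.sub_mem h2 hx.1
    · obtain ⟨r, u⟩ := x
      obtain ⟨s, w⟩ := y
      simp only [Finset.mem_product, mem_cosetZeros] at hx hy h
      have hrs : r = s := by
        by_contra hne
        have h1 : ((r : F) - s) • e ∈ ℓ := by
          have : ((r : F) - s) • e = (s : F) • w - (r : F) • u := by
            rw [Units.smul_def, Units.smul_def, smul_add, smul_add] at h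
            rw [sub_smul, sub_eq_sub_iff_add_eq_add, h, add_comm]
          rw [this]
          exact ℓ.sub_mem (ℓ.smul_mem _ hy.2.1) (ℓ.smul_mem _ hx.2.1)
        refine he ((ℓ.smul_mem_iff (sub_ne_zero.2 fun h => hne (Units.ext h))).1 h1)
      subst hrs
      have := smul_left_cancel r h
      rw [add_left_cancel this]
    · simp only [Finset.mem_filter, Finset.mem_univ, true_and] at hv
      obtain ⟨⟨hv1, hv2⟩, hv3⟩ := hv
      obtain ⟨r, hr⟩ := exists_sub_smul_mem_of_finrank hℓker hℓ.1 hker heD he hv1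
      have hr0 : r ≠ 0 := fun h => hv3 (by simpa [h] using hr)
      refine ⟨(Units.mk0 r hr0, r⁻¹ • (v - r • e)), ?_, ?_⟩
      · simp only [Finset.mem_product, Finset.mem_univ, true_and, mem_cosetZeros]
        refine ⟨ℓ.smul_mem _ hr, ?_⟩
        rw [smul_sub, inv_smul_smul₀ hr0, add_sub_cancel]
        exact hS.eval_smul hv2 _
      · rw [Units.smul_def, Units.val_mk0, smul_add, smul_inv_smul₀ hr0, add_sub_cancel]

end IsTightSurface

end Surface

section Higman

open Finset

/-- Higman's inequality for a strongly regular graph with the parameters of the line graph of a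
generalised quadrangle of order `(q, t)`. -/
theorem SimpleGraph.IsSRGWith.le_sq_of_forall_not_adj {V : Type*} [Fintype V] [DecidableEq V]
    {G : SimpleGraph V} [DecidableRel G.Adj] {v q t : ℕ}
    (h : G.IsSRGWith v ((q + 1) * t) (t - 1) (q + 1)) (hq : 2 ≤ q) (ht : 2 ≤ t)
    (htri : ∀ a b c d, a ≠ b → ¬ G.Adj a b → G.Adj a c → G.Adj b c → G.Adj a d → G.Adj b d →
      ¬ G.Adj c d) [Nonempty V] : q ≤ t ^ 2 := by
  have hN : ∀ a b, Fintype.card (G.commonNeighbors a b) =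
      (univ.filter fun c => G.Adj a c ∧ G.Adj b c).card := fun a b => by
    rw [Fintype.card_subtype]; rfl
  have hdeg : ∀ a, (univ.filter fun c => G.Adj a c).card = (q + 1) * t := fun a => by
    rw [← h.regular a, ← G.card_neighborFinset_eq_degree]
    congr 1; ext c; simp
  have hadj : ∀ a b, G.Adj a b → (univ.filter fun c => G.Adj a c ∧ G.Adj b c).card = t - 1 :=
    fun a b hab => by rw [← hN, h.of_adj a b hab]
  have hnadj : ∀ a b, a ≠ b → ¬ G.Adj a b →
      (univ.filter fun c => G.Adj a c ∧ G.Adj b c).card = q + 1 :=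
    fun a b hab hab' => by rw [← hN]; exact h.of_not_adj hab hab'
  obtain ⟨r, rfl⟩ : ∃ r, t = r + 1 := ⟨t - 1, by omega⟩
  obtain ⟨a⟩ := ‹Nonempty V›
  have hcard : Fintype.card V = v := h.card
  have hv : v = 1 + (q + 1) * (r + 1) + q * (r + 1) ^ 2 := by
    have hv0 : 0 < v := by rw [← hcard]; exact Fintype.card_pos_iff.2 ⟨a⟩
    have h1 := SimpleGraph.IsSRGWith.param_eq G h hv0
    have h2 : (q + 1) * (r + 1) - (r + 1 - 1) - 1 = q * (r + 1) := by
      rw [add_mul, one_mul]; omega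
    rw [h2] at h1
    have h3 : (v - (q + 1) * (r + 1) - 1) = (r + 1) * (q * (r + 1)) :=
      Nat.eq_of_mul_eq_mul_right (by omega : 0 < q + 1) (by rw [← h1]; ring)
    have h4 : 0 < (r + 1) * (q * (r + 1)) := by positivity
    have h5 : (r + 1) * (q * (r + 1)) = q * (r + 1) ^ 2 := by ring
    omega
  obtain ⟨b, hab, hnab⟩ : ∃ b, a ≠ b ∧ ¬ G.Adj a b := by
    by_contra! hall
    have h1 : (univ : Finset V) ⊆ insert a (univ.filter fun c => G.Adj a c) := fun c _ => by
      by_cases hc : a = c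
      · simp [hc]
      · simp [hall c hc]
    have h2 := (card_le_card h1).trans (card_insert_le _ _)
    rw [hdeg, card_univ, hcard, hv] at h2
    have : 0 < q * (r + 1) ^ 2 := by positivity
    omega
  set W := univ.filter fun c => a ≠ c ∧ b ≠ c ∧ ¬ G.Adj a c ∧ ¬ G.Adj b c with hW
  set C := univ.filter fun c => G.Adj a c ∧ G.Adj b c with hC
  have hmemC : ∀ c, c ∈ C ↔ G.Adj a c ∧ G.Adj b c := fun c => by simp [hC]
  have hCcard : C.card = q + 1 := hnadj a b hab hnab
  have hWcard : W.card + 2 + 2 * ((q + 1) * (r + 1)) = v + (q + 1) := by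
    have h1 := card_filter_add_card_filter_not (s := (univ : Finset V))
      (fun c => a ≠ c ∧ b ≠ c ∧ ¬ G.Adj a c ∧ ¬ G.Adj b c)
    have h2 : (univ.filter fun c => ¬ (a ≠ c ∧ b ≠ c ∧ ¬ G.Adj a c ∧ ¬ G.Adj b c)) =
        insert a (insert b ((univ.filter fun c => G.Adj a c) ∪
          univ.filter fun c => G.Adj b c)) := by
      ext c
      simp only [mem_filter, mem_univ, true_and, mem_insert, mem_union, eq_comm (a := c)]
      tauto
    have h3 := card_union_add_card_inter (univ.filter fun c => G.Adj a c)
      (univ.filter fun c => G.Adj b c)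
    rw [← filter_and, hdeg, hdeg] at h3
    rw [h2, card_insert_of_notMem, card_insert_of_notMem, card_univ, hcard] at h1
    · change W.card + _ = _ at h1
      change _ + C.card = _ at h3
      rw [hCcard] at h3
      omega
    · simp [hnab]
    · simp [G.adj_comm b a, hnab, hab]
  have hWT : ∀ c ∈ C, (W.filter fun d => G.Adj c d).card = (q - 1) * (r + 1) := by
    intro c hc
    obtain ⟨hac, hbc⟩ := (hmemC c).1 hc
    have h1 := card_filter_add_card_filter_not (s := univ.filter fun d => G.Adj c d)
      (fun d => a ≠ d ∧ b ≠ d ∧ ¬ G.Adj a d ∧ ¬ G.Adj b d)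
    rw [hdeg, filter_filter, filter_filter] at h1
    have h2 : (univ.filter fun d => G.Adj c d ∧ ¬ (a ≠ d ∧ b ≠ d ∧ ¬ G.Adj a d ∧ ¬ G.Adj b d)) =
        insert a (insert b ((univ.filter fun d => G.Adj a d ∧ G.Adj c d) ∪
          univ.filter fun d => G.Adj b d ∧ G.Adj c d)) := by
      ext d
      simp only [mem_filter, mem_univ, true_and, mem_insert, mem_union]
      constructor
      · rintro ⟨h1, h2⟩
        simp only [eq_comm (a := d)]
        tauto
      · rintro (rfl | rfl | h | h)
        · exact ⟨hac.symm, by simp⟩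
        · exact ⟨hbc.symm, by simp⟩
        · exact ⟨h.2, by tauto⟩
        · exact ⟨h.2, by tauto⟩
    rw [h2, card_insert_of_notMem, card_insert_of_notMem, card_union_of_disjoint, hadj _ _ hac,
      hadj _ _ hbc] at h1
    · have h3 : (W.filter fun d => G.Adj c d) = univ.filter fun d => G.Adj c d ∧
          (a ≠ d ∧ b ≠ d ∧ ¬ G.Adj a d ∧ ¬ G.Adj b d) := by
        ext d; simp only [hW, mem_filter, mem_univ, true_and]; tauto
      rw [h3]
      obtain ⟨p, rfl⟩ : ∃ p, q = p + 1 := ⟨q - 1, by omega⟩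
      have h4 : (p + 1 + 1) * (r + 1) = p * (r + 1) + 2 * (r + 1) := by ring
      simp only [Nat.add_sub_cancel]
      simp only [Nat.add_sub_cancel] at h1
      omega
    · rw [disjoint_filter]
      exact fun d _ h1 h2 => htri a b c d hab hnab hac hbc h1.1 h2.1 h1.2
    · simp [hnab]
    · simp [G.adj_comm b a, hnab, hab]
  have hWTT : ∀ c ∈ C, ∀ d ∈ C, c ≠ d →
      (W.filter fun x => G.Adj c x ∧ G.Adj d x).card = q - 1 := by
    intro c hc d hd hcd
    obtain ⟨hac, hbc⟩ := (hmemC c).1 hc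
    obtain ⟨had, hbd⟩ := (hmemC d).1 hd
    have hncd := htri a b c d hab hnab hac hbc had hbd
    have h1 := hnadj c d hcd hncd
    have h2 : (univ.filter fun x => G.Adj c x ∧ G.Adj d x) =
        insert a (insert b (W.filter fun x => G.Adj c x ∧ G.Adj d x)) := by
      ext x
      simp only [hW, mem_filter, mem_univ, true_and, mem_insert]
      constructor
      · rintro ⟨h1, h2⟩
        have h3 := htri c d a x hcd hncd hac.symm had.symm h1 h2
        have h4 := htri c d b x hcd hncd hbc.symm hbd.symm h1 h2
        simp only [eq_comm (a := x)]
        tauto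
      · rintro (rfl | rfl | h)
        · exact ⟨hac.symm, had.symm⟩
        · exact ⟨hbc.symm, hbd.symm⟩
        · exact h.2
    rw [h2, card_insert_of_notMem, card_insert_of_notMem] at h1
    · omega
    · simp [hW]
    · simp [hW, hab]
  have hsum : ∑ x ∈ W, (C.filter fun c => G.Adj c x).card = (q + 1) * ((q - 1) * (r + 1)) := by
    have h1 := sum_card_bipartiteAbove_eq_sum_card_bipartiteBelow (s := C) (t := W) G.Adj
    have h2 : ∀ c ∈ C, (bipartiteAbove G.Adj W c).card = (q - 1) * (r + 1) := hWT
    rw [sum_congr rfl h2, sum_const, hCcard, smul_eq_mul] at h1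
    exact h1.symm
  have hsq : ∑ x ∈ W, (C.filter fun c => G.Adj c x).card ^ 2 =
      (q + 1) * ((q - 1) * (r + 1) + q * (q - 1)) := by
    have h1 := sum_card_bipartiteAbove_eq_sum_card_bipartiteBelow (s := C ×ˢ C) (t := W)
      fun y x => G.Adj y.1 x ∧ G.Adj y.2 x
    have h2 : ∀ x, (bipartiteBelow (fun (y : V × V) x => G.Adj y.1 x ∧ G.Adj y.2 x)
        (C ×ˢ C) x).card = (C.filter fun c => G.Adj c x).card ^ 2 := fun x => by
      rw [bipartiteBelow, sq, ← card_product]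
      congr 1
      ext y
      simp only [mem_filter, mem_product]
      tauto
    simp only [h2] at h1
    rw [← h1, sum_product, ← hCcard, ← smul_eq_mul, ← sum_const]
    refine sum_congr rfl fun c hc => ?_
    rw [← add_sum_erase _ _ hc]
    congr 1
    · rw [← hWT c hc]
      simp [bipartiteAbove]
    · have h3 : (C.erase c).card = q := by rw [card_erase_of_mem hc, hCcard, Nat.add_sub_cancel]
      have h4 : ∀ d ∈ C.erase c, (bipartiteAbove
          (fun (y : V × V) x => G.Adj y.1 x ∧ G.Adj y.2 x) W (c, d)).card = q - 1 := fun d hd =>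
        hWTT c hc d (mem_of_mem_erase hd) (ne_of_mem_erase hd).symm
      rw [sum_congr rfl h4, sum_const, h3, smul_eq_mul]
  have hcs := sq_sum_le_card_mul_sum_sq (s := W) (f := fun x => (C.filter fun c => G.Adj c x).card)
  rw [hsum, hsq] at hcs
  obtain ⟨p, rfl⟩ : ∃ p, q = p + 1 := ⟨q - 1, by omega⟩
  rw [hv] at hWcard
  simp only [Nat.add_sub_cancel] at hcs
  have hp0 : 0 < p := by omega
  have hp : 0 < (p + 1 + 1) * p := by positivity
  have hW' : (W.card : ℤ) = (p + 1) * (r + 1) ^ 2 - (r + 1) - (p + 1) * (r + 1) + (p + 1) := by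
    zify at hWcard
    linarith
  have hcs' : ((p + 1 + 1 : ℤ) * p) * (((p + 1 + 1) * p) * (r + 1) ^ 2) ≤
      ((p + 1 + 1 : ℤ) * p) * (W.card * (r + 1 + (p + 1))) := by
    zify at hcs
    linarith
  have hp' : (0 : ℤ) < (p + 1 + 1 : ℤ) * p := by exact_mod_cast hp
  have h1 := le_of_mul_le_mul_left hcs' hp'
  rw [hW'] at h1
  have h2 : (0 : ℤ) ≤ ((p + 1) * r) * ((r + 1) ^ 2 - (p + 1)) := by linarith
  have hr : 0 < r := by omega
  have h3 : (0 : ℤ) < (p + 1) * r := by positivity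
  have h4 := nonneg_of_mul_nonneg_right h2 h3
  zify
  linarith

end Higman

section LineGraph

open MvPolynomial
open scoped Classical

/-- The graph whose vertices are the lines of the surface `f = 0`, adjacent when they meet. -/
def lineGraph {F : Type*} [Field F] (f : MvPolynomial (Fin 4) F) :
    SimpleGraph {ℓ : Submodule F (Fin 4 → F) // IsXLine f ℓ} where
  Adj a b := a ≠ b ∧ a.1 ⊓ b.1 ≠ ⊥
  symm := ⟨fun _ _ h => ⟨h.1.symm, by rw [inf_comm]; exact h.2⟩⟩
  loopless := ⟨fun _ h => h.1 rfl⟩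

variable {F : Type*} [Field F] {f : MvPolynomial (Fin 4) F} {t : ℕ}

theorem lineGraph_adj {a b : {ℓ : Submodule F (Fin 4 → F) // IsXLine f ℓ}} :
    (lineGraph f).Adj a b ↔ a ≠ b ∧ a.1 ⊓ b.1 ≠ ⊥ := Iff.rfl

theorem IsXLine.eq_of_mem {ℓ m : Submodule F (Fin 4 → F)} (hℓ : IsXLine f ℓ) (hm : IsXLine f m)
    {p x : Fin 4 → F} (hp0 : p ≠ 0) (hx : x ∉ Submodule.span F {p}) (hpℓ : p ∈ ℓ) (hxℓ : x ∈ ℓ)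
    (hpm : p ∈ m) (hxm : x ∈ m) : ℓ = m := by
  have h : ∀ ℓ, IsXLine f ℓ → p ∈ ℓ → x ∈ ℓ →
      Submodule.span F {p} ⊔ Submodule.span F {x} = ℓ := fun ℓ hℓ hp hx' => by
    refine Submodule.eq_of_le_of_finrank_eq (sup_le
      ((Submodule.span_singleton_le_iff_mem _ _).2 hp)
      ((Submodule.span_singleton_le_iff_mem _ _).2 hx')) ?_
    rw [finrank_sup_span_singleton hx, finrank_span_singleton hp0, hℓ.1]
  rw [← h ℓ hℓ hpℓ hxℓ, h m hm hpm hxm]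

theorem finrank_inf_of_lineGraph_adj {a b : {ℓ : Submodule F (Fin 4 → F) // IsXLine f ℓ}}
    (h : (lineGraph f).Adj a b) : Module.finrank F ↥(a.1 ⊓ b.1) = 1 := by
  have h1 := Submodule.one_le_finrank_iff.2 h.2
  have h2 : Module.finrank F ↥(a.1 ⊓ b.1) < 2 := by
    rw [← a.2.1]
    refine Submodule.finrank_lt_finrank_of_lt (lt_of_le_of_ne inf_le_left fun h' => h.1 ?_)
    exact Subtype.ext (Submodule.eq_of_le_of_finrank_eq (inf_eq_left.1 h') (by rw [a.2.1, b.2.1]))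
  omega

variable [Fintype F]

noncomputable instance (f : MvPolynomial (Fin 4) F) :
    Fintype {ℓ : Submodule F (Fin 4 → F) // IsXLine f ℓ} :=
  have : Finite (Submodule F (Fin 4 → F)) := Finite.of_injective _ SetLike.coe_injective
  Fintype.ofFinite _

theorem card_filter_mem_ne_zero {n : ℕ} (L : Submodule F (Fin n → F)) :
    (Finset.univ.filter fun x => x ∈ L ∧ x ≠ 0).card =
      Fintype.card F ^ Module.finrank F L - 1 := by
  rw [← card_filter_mem_submodule, ← Finset.card_erase_of_mem (a := 0) (by simp)]
  congr 1
  ext x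
  simp [and_comm]

theorem card_filter_mem_notMem {n : ℕ} {K L : Submodule F (Fin n → F)} (h : K ≤ L) :
    (Finset.univ.filter fun x => x ∈ L ∧ x ∉ K).card =
      Fintype.card F ^ Module.finrank F L - Fintype.card F ^ Module.finrank F K := by
  rw [← card_filter_mem_submodule, ← card_filter_mem_submodule, ← Finset.card_sdiff_of_subset]
  · congr 1
    ext x
    simp
  · intro x hx
    simpa using h (by simpa using hx)

namespace IsTightSurface

theorem card_lines_through (hS : IsTightSurface f t) {p : Fin 4 → F} (hp : eval p f = 0)
    (hp0 : p ≠ 0) :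
    (Finset.univ.filter fun a : {ℓ // IsXLine f ℓ} => p ∈ a.1).card = t + 1 := by
  have hq : 2 ≤ Fintype.card F := by have := hS.one_le; have := hS.lt_card; omega
  have hspan : Module.finrank F (Submodule.span F {p}) = 1 := finrank_span_singleton hp0
  have hDp : dirDeriv f p p = 0 := by
    obtain ⟨ℓ, hℓ, hpℓ⟩ := hS.exists_line_through hp
    exact hS.dirDeriv_eq_zero hℓ hpℓ hpℓ
  set T := Finset.univ.filter fun x =>
    (dirDeriv f p x = 0 ∧ eval x f = 0) ∧ x ∉ Submodule.span F {p} with hT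
  have hTcard : T.card + Fintype.card F =
      Fintype.card F ^ 2 + (Fintype.card F - 1) * (t * Fintype.card F) := by
    have h0 := Finset.card_filter_add_card_filter_not
      (s := Finset.univ.filter fun x => dirDeriv f p x = 0 ∧ eval x f = 0)
      (fun v => v ∈ Submodule.span F {p})
    rw [Finset.filter_filter, Finset.filter_filter, ← hT] at h0
    rw [← hS.card_tangent_plane_zeros hp hp0, ← h0, add_comm]
    congr 1
    have h1 := card_filter_mem_submodule (Submodule.span F {p})
    rw [hspan, pow_one] at h1
    rw [← h1]
    congr 1
    ext x
    simp only [Finset.mem_filter, Finset.mem_univ, true_and]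
    refine ⟨fun h => ⟨?_, h⟩, fun h => h.2⟩
    obtain ⟨r, rfl⟩ := Submodule.mem_span_singleton.1 h
    exact ⟨by rw [map_smul, hDp, smul_zero], hS.eval_smul hp r⟩
  have h := Finset.card_mul_eq_card_mul
    (s := Finset.univ.filter fun a : {ℓ // IsXLine f ℓ} => p ∈ a.1) (t := T)
    (m := Fintype.card F ^ 2 - Fintype.card F) (n := 1) (fun a x => x ∈ a.1) ?_ ?_
  · obtain ⟨r, hr⟩ : ∃ r, Fintype.card F = r + 2 := ⟨Fintype.card F - 2, by omega⟩
    rw [hr] at h hTcard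
    have h1 : (r + 2) ^ 2 - (r + 2) = (r + 1) * (r + 2) :=
      Nat.sub_eq_of_eq_add (by ring)
    have h2 : r + 2 - 1 = r + 1 := rfl
    rw [h1, mul_one] at h
    rw [h2] at hTcard
    refine Nat.eq_of_mul_eq_mul_right (by positivity : 0 < (r + 1) * (r + 2)) ?_
    rw [h]
    nlinarith
  · intro a ha
    have hpa : p ∈ a.1 := by simpa using ha
    have hle : Submodule.span F {p} ≤ a.1 := (Submodule.span_singleton_le_iff_mem _ _).2 hpa
    have h1 := card_filter_mem_notMem hle
    rw [a.2.1, hspan, pow_one] at h1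
    rw [← h1]
    congr 1
    ext x
    simp only [Finset.mem_bipartiteAbove, hT, Finset.mem_filter, Finset.mem_univ, true_and]
    exact ⟨fun h => ⟨h.2, h.1.2⟩, fun h =>
      ⟨⟨⟨hS.dirDeriv_eq_zero a.2 hpa h.1, a.2.2 x h.1⟩, h.2⟩, h.1⟩⟩
  · intro x hx
    obtain ⟨⟨h1, h2⟩, h3⟩ := (Finset.mem_filter.1 hx).2
    have hpm : p ∈ Submodule.span F {p} ⊔ Submodule.span F {x} :=
      Submodule.mem_sup_left (Submodule.mem_span_singleton_self p)
    have hxm : x ∈ Submodule.span F {p} ⊔ Submodule.span F {x} :=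
      Submodule.mem_sup_right (Submodule.mem_span_singleton_self x)
    have hm := hS.isXLine_of_dirDeriv_eq_zero hp hp0 h2 h3 h1
    refine Finset.card_eq_one.2 ⟨⟨_, hm⟩, ?_⟩
    ext a
    simp only [Finset.mem_bipartiteBelow, Finset.mem_filter, Finset.mem_univ, true_and,
      Finset.mem_singleton]
    constructor
    · rintro ⟨hpa, hxa⟩
      exact Subtype.ext (a.2.eq_of_mem hm hp0 h3 hpa hxa hpm hxm)
    · rintro rfl
      exact ⟨hpm, hxm⟩

theorem mem_of_meet (hS : IsTightSurface f t) {a b c : {ℓ // IsXLine f ℓ}} (hab : a ≠ b)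
    {p : Fin 4 → F} (hpa : p ∈ a.1) (hpb : p ∈ b.1) (hac : a.1 ⊓ c.1 ≠ ⊥)
    (hbc : b.1 ⊓ c.1 ≠ ⊥) : p ∈ c.1 := by
  by_contra hpc
  have h := hS.existsUnique_line_meeting c.2 (a.2.2 p hpa) hpc
  exact hab (Subtype.ext (h.unique ⟨a.2, hpa, hac⟩ ⟨b.2, hpb, hbc⟩))

theorem isSRGWith_lineGraph (hS : IsTightSurface f t) :
    (lineGraph f).IsSRGWith (Fintype.card {ℓ // IsXLine f ℓ}) ((Fintype.card F + 1) * t)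
      (t - 1) (Fintype.card F + 1) := by
  have hq : 2 ≤ Fintype.card F := by have := hS.one_le; have := hS.lt_card; omega
  have hpts : ∀ a : {ℓ // IsXLine f ℓ}, (Finset.univ.filter fun x => x ∈ a.1 ∧ x ≠ 0).card =
      (Fintype.card F + 1) * (Fintype.card F - 1) := fun a => by
    rw [card_filter_mem_ne_zero, a.2.1, ← Nat.sq_sub_sq, one_pow]
  have hmeet : ∀ a b : {ℓ // IsXLine f ℓ}, (lineGraph f).Adj a b →
      (Finset.bipartiteAbove (fun (b : {ℓ // IsXLine f ℓ}) x => x ∈ b.1)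
        (Finset.univ.filter fun x => x ∈ a.1 ∧ x ≠ 0) b).card = Fintype.card F - 1 := by
    intro a b hab
    have h1 := card_filter_mem_ne_zero (a.1 ⊓ b.1)
    rw [finrank_inf_of_lineGraph_adj hab, pow_one] at h1
    rw [← h1]
    congr 1
    ext x
    simp only [Finset.mem_bipartiteAbove, Finset.mem_filter, Finset.mem_univ, true_and,
      Submodule.mem_inf]
    tauto
  refine ⟨rfl, fun a => ?_, fun a b hab => ?_, fun a b hab hnab => ?_⟩
  · rw [← SimpleGraph.card_neighborFinset_eq_degree]
    have h := Finset.card_mul_eq_card_mul (s := (lineGraph f).neighborFinset a)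
      (t := Finset.univ.filter fun x => x ∈ a.1 ∧ x ≠ 0) (m := Fintype.card F - 1) (n := t)
      (fun b x => x ∈ b.1) (fun b hb => hmeet a b (by simpa using hb)) ?_
    · rw [hpts] at h
      exact Nat.eq_of_mul_eq_mul_right (by omega : 0 < Fintype.card F - 1)
        (by rw [h]; ring)
    · intro x hx
      obtain ⟨hxa, hx0⟩ := (Finset.mem_filter.1 hx).2
      have h1 := hS.card_lines_through (a.2.2 x hxa) hx0
      rw [← Nat.add_sub_cancel (n := t) (m := 1), ← h1,
        ← Finset.card_erase_of_mem (a := a) (by simpa using hxa)]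
      congr 1
      ext b
      simp only [Finset.mem_bipartiteBelow, SimpleGraph.mem_neighborFinset, Finset.mem_erase,
        Finset.mem_filter, Finset.mem_univ, true_and]
      refine ⟨fun h => ⟨h.1.1.symm, h.2⟩, fun h => ⟨⟨h.1.symm, ?_⟩, h.2⟩⟩
      exact (Submodule.ne_bot_iff _).2 ⟨x, ⟨hxa, h.2⟩, hx0⟩
  · obtain ⟨p, ⟨hpa, hpb⟩, hp0⟩ := (Submodule.ne_bot_iff _).1 hab.2
    have h1 := hS.card_lines_through (a.2.2 p hpa) hp0
    have h2 : (((Finset.univ.filter fun a : {ℓ // IsXLine f ℓ} => p ∈ a.1).erase a).erase b).card =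
        t - 1 := by
      rw [Finset.card_erase_of_mem (by simpa [hab.1.symm] using hpb),
        Finset.card_erase_of_mem (by simpa using hpa), h1, Nat.add_sub_cancel]
    rw [← h2, Fintype.card_subtype]
    congr 1
    ext c
    simp only [SimpleGraph.mem_commonNeighbors, Finset.mem_erase, Finset.mem_filter,
      Finset.mem_univ, true_and, lineGraph_adj]
    constructor
    · rintro ⟨h3, h4⟩
      exact ⟨h4.1.symm, h3.1.symm, hS.mem_of_meet hab.1 hpa hpb h3.2 h4.2⟩
    · rintro ⟨h3, h4, h5⟩
      exact ⟨⟨h4.symm, (Submodule.ne_bot_iff _).2 ⟨p, ⟨hpa, h5⟩, hp0⟩⟩,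
        ⟨h3.symm, (Submodule.ne_bot_iff _).2 ⟨p, ⟨hpb, h5⟩, hp0⟩⟩⟩
  · have hbot : a.1 ⊓ b.1 = ⊥ := by
      by_contra h
      exact hnab ⟨hab, h⟩
    rw [Fintype.card_subtype]
    have h := Finset.card_mul_eq_card_mul
      (s := Finset.univ.filter fun c => c ∈ (lineGraph f).commonNeighbors a b)
      (t := Finset.univ.filter fun x => x ∈ a.1 ∧ x ≠ 0) (m := Fintype.card F - 1) (n := 1)
      (fun b x => x ∈ b.1) (fun c hc => hmeet a c (by
        simp only [SimpleGraph.mem_commonNeighbors, Finset.mem_filter, Finset.mem_univ,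
          true_and] at hc
        exact hc.1)) ?_
    · rw [hpts, mul_one] at h
      exact Nat.eq_of_mul_eq_mul_right (by omega : 0 < Fintype.card F - 1) h
    · intro x hx
      obtain ⟨hxa, hx0⟩ := (Finset.mem_filter.1 hx).2
      have hxb : x ∉ b.1 := fun hxb => hx0 <| by
        have : x ∈ a.1 ⊓ b.1 := ⟨hxa, hxb⟩
        rwa [hbot, Submodule.mem_bot] at this
      obtain ⟨m, ⟨hm, hxm, hmb⟩, hu⟩ := hS.existsUnique_line_meeting b.2 (a.2.2 x hxa) hxb
      refine Finset.card_eq_one.2 ⟨⟨m, hm⟩, ?_⟩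
      ext c
      simp only [Finset.mem_bipartiteBelow, SimpleGraph.mem_commonNeighbors, Finset.mem_filter,
        Finset.mem_univ, true_and, Finset.mem_singleton, lineGraph_adj]
      constructor
      · rintro ⟨⟨-, hc⟩, hxc⟩
        exact Subtype.ext (hu _ ⟨c.2, hxc, by rw [inf_comm]; exact hc.2⟩)
      · rintro rfl
        refine ⟨⟨⟨?_, ?_⟩, ?_, ?_⟩, hxm⟩
        · rintro rfl; exact hmb hbot
        · exact (Submodule.ne_bot_iff _).2 ⟨x, ⟨hxa, hxm⟩, hx0⟩
        · rintro rfl; exact hxb hxm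
        · rwa [inf_comm]

theorem card_le_sq (hS : IsTightSurface f t) (ht : 2 ≤ t) : Fintype.card F ≤ t ^ 2 := by
  have hq : 2 ≤ Fintype.card F := by have := hS.lt_card; omega
  obtain ⟨ℓ, hℓ⟩ := hS.exists_line
  have : Nonempty {ℓ // IsXLine f ℓ} := ⟨⟨ℓ, hℓ⟩⟩
  refine hS.isSRGWith_lineGraph.le_sq_of_forall_not_adj hq ht ?_
  intro a b c d hab hnab hac hbc had hbd hcd
  obtain ⟨p, ⟨hpc, hpd⟩, hp0⟩ := (Submodule.ne_bot_iff _).1 hcd.2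
  exact hnab ⟨hab, (Submodule.ne_bot_iff _).2 ⟨p,
    ⟨hS.mem_of_meet hcd.1 hpc hpd hac.symm.2 had.symm.2,
      hS.mem_of_meet hcd.1 hpc hpd hbc.symm.2 hbd.symm.2⟩, hp0⟩⟩

end IsTightSurface

end LineGraph

section PlaneSection

open MvPolynomial
open scoped Classical

variable {F : Type*} [Field F] [Fintype F]

theorem sum_card_filter_add_smul {V : Type*} [AddCommGroup V] [Module F V] {S : Finset V} {u : V}
    (hS : ∀ v (r : F), v + r • u ∈ S ↔ v ∈ S) (P : V → Prop) :
    ∑ e ∈ S, (Finset.univ.filter fun r : F => P (e + r • u)).card =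
      Fintype.card F * (S.filter P).card := by
  rw [← Finset.card_univ, ← Finset.card_product, ← Finset.card_sigma]
  refine Finset.card_bij' (fun x _ => (x.2, x.1 + x.2 • u)) (fun y _ => ⟨y.2 - y.1 • u, y.1⟩)
    (fun x hx => ?_) (fun y hy => ?_) (fun x hx => ?_) (fun y hy => ?_)
  · simp only [Finset.mem_sigma, Finset.mem_filter, Finset.mem_univ, true_and,
      Finset.mem_product] at hx ⊢
    exact ⟨(hS _ _).2 hx.1, hx.2⟩
  · simp only [Finset.mem_sigma, Finset.mem_filter, Finset.mem_univ, true_and,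
      Finset.mem_product] at hy ⊢
    refine ⟨(hS _ y.1).1 ?_, ?_⟩
    · simpa using hy.1
    · simpa using hy.2
  · simp
  · simp

namespace IsTightSurface

variable {f : MvPolynomial (Fin 4) F} {t : ℕ} {b : Submodule F (Fin 4 → F)}

theorem card_filter_eval_add_smul (hS : IsTightSurface f t) {p e : Fin 4 → F}
    (hp : eval p f = 0) (he : dirDeriv f p e ≠ 0) :
    (Finset.univ.filter fun r : F => eval (e + r • p) f = 0).card = t := by
  obtain ⟨ℓ, hℓ, hpℓ⟩ := hS.exists_line_through hp
  have heℓ : e ∉ ℓ := fun h => he (hS.dirDeriv_eq_zero hℓ hpℓ h)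
  obtain ⟨M, hMℓ, hM, hinv, hD⟩ := hS.structure_of_notMem hℓ heℓ
  have hpM : p ∉ M := fun h => he ((hD p hpℓ).2 h)
  have h1 := hS.tight ℓ hℓ e heℓ
  have h2 := card_filter_mem_submodule M
  rw [hM, pow_one] at h2
  refine Nat.eq_of_mul_eq_mul_right (Fintype.card_pos (α := F)) ?_
  rw [← h1, ← h2, ← Finset.card_product]
  refine Finset.card_bij (fun x _ => x.1 • p + x.2) (fun x hx => ?_) (fun x hx y hy h => ?_)
    (fun w hw => ?_)
  · simp only [Finset.mem_product, Finset.mem_filter, Finset.mem_univ, true_and] at hx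
    refine mem_cosetZeros.2 ⟨ℓ.add_mem (ℓ.smul_mem _ hpℓ) (hMℓ hx.2), ?_⟩
    rw [← add_assoc]
    exact hinv _ (ℓ.smul_mem _ hpℓ) hx.1 _ hx.2
  · simp only [Finset.mem_product, Finset.mem_filter, Finset.mem_univ, true_and] at hx hy
    have h3 : (x.1 - y.1) • p ∈ M := by
      have : (x.1 - y.1) • p = y.2 - x.2 := by
        rw [sub_smul, sub_eq_sub_iff_add_eq_add, h, add_comm]
      rw [this]
      exact M.sub_mem hy.2 hx.2
    have h4 : x.1 = y.1 := by
      by_contra hne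
      exact hpM ((M.smul_mem_iff (sub_ne_zero.2 hne)).1 h3)
    refine Prod.ext h4 ?_
    rw [h4] at h
    exact add_left_cancel h
  · obtain ⟨hwℓ, hw⟩ := mem_cosetZeros.1 hw
    obtain ⟨r, hr⟩ := exists_sub_smul_mem_of_finrank hMℓ hM hℓ.1 hpℓ hpM hwℓ
    refine ⟨(r, w - r • p), ?_, by simp⟩
    simp only [Finset.mem_product, Finset.mem_filter, Finset.mem_univ, true_and]
    refine ⟨?_, hr⟩
    have := hinv w hwℓ hw _ (M.neg_mem hr)
    rwa [show e + w + -(w - r • p) = e + r • p by abel] at this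

theorem exists_plane_without_line (hS : IsTightSurface f t) :
    ∃ b : Submodule F (Fin 4 → F), Module.finrank F b = 3 ∧ ∀ m, IsXLine f m → ¬ m ≤ b := by
  obtain ⟨ℓ, hℓ⟩ := hS.exists_line
  obtain ⟨p, hpℓ, hp0⟩ : ∃ p ∈ ℓ, p ≠ 0 := by
    refine (Submodule.ne_bot_iff ℓ).1 fun h => ?_
    have := hℓ.1
    rw [h, finrank_bot] at this; omega
  have hp := hℓ.2 p hpℓ
  have hker := hS.finrank_ker_dirDeriv hp hp0
  obtain ⟨y, hy, hyf⟩ : ∃ y ∈ LinearMap.ker (dirDeriv f p), eval y f ≠ 0 := by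
    have := hS.no_plane _ hker
    push Not at this
    exact this
  obtain ⟨z, -, hz⟩ : ∃ z ∈ (⊤ : Submodule F (Fin 4 → F)), z ∉ LinearMap.ker (dirDeriv f p) := by
    refine SetLike.not_le_iff_exists.1 fun h => ?_
    have := Submodule.finrank_mono h
    rw [finrank_top, Module.finrank_fin_fun] at this
    omega
  have hpp : dirDeriv f p p = 0 := hS.dirDeriv_eq_zero hℓ hpℓ hpℓ
  have hyp : y ∉ Submodule.span F {p} := fun h => hyf <| by
    obtain ⟨r, rfl⟩ := Submodule.mem_span_singleton.1 h
    exact hS.eval_smul hp r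
  set c := Submodule.span F {p} ⊔ Submodule.span F {y} with hc
  have hcker : c ≤ LinearMap.ker (dirDeriv f p) := sup_le
    ((Submodule.span_singleton_le_iff_mem _ _).2 hpp)
    ((Submodule.span_singleton_le_iff_mem _ _).2 hy)
  have hpc : p ∈ c := Submodule.mem_sup_left (Submodule.mem_span_singleton_self p)
  have hyc : y ∈ c := Submodule.mem_sup_right (Submodule.mem_span_singleton_self y)
  have hc2 : Module.finrank F c = 2 := by
    rw [finrank_sup_span_singleton hyp, finrank_span_singleton hp0]
  have hzc : z ∉ c := fun h => hz (hcker h)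
  have hb : Module.finrank F ↥(c ⊔ Submodule.span F {z}) = 3 := by
    rw [finrank_sup_span_singleton hzc, hc2]
  refine ⟨c ⊔ Submodule.span F {z}, hb, fun m hm hmb => ?_⟩
  obtain ⟨x, ⟨hxm, hxc⟩, hx0⟩ : ∃ x ∈ m ⊓ c, x ≠ 0 := by
    refine (Submodule.ne_bot_iff _).1 fun h => ?_
    have h1 := Submodule.finrank_sup_add_finrank_inf_eq m c
    rw [h, finrank_bot, hm.1, hc2] at h1
    have h2 := Submodule.finrank_mono (sup_le hmb (le_sup_left : c ≤ c ⊔ Submodule.span F {z}))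
    omega
  by_cases hxp : x ∈ Submodule.span F {p}
  · obtain ⟨r, rfl⟩ := Submodule.mem_span_singleton.1 hxp
    have hr : r ≠ 0 := fun h => hx0 (by rw [h, zero_smul])
    have hpm : p ∈ m := (m.smul_mem_iff hr).1 hxm
    have hmc : m ≤ c := fun v hv => by
      obtain ⟨w, hw, u, hu, rfl⟩ := Submodule.mem_sup.1 (hmb hv)
      obtain ⟨s, rfl⟩ := Submodule.mem_span_singleton.1 hu
      have h1 := hS.dirDeriv_eq_zero hm hpm hv
      rw [map_add, LinearMap.mem_ker.1 (hcker hw), zero_add, map_smul, smul_eq_mul,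
        mul_eq_zero] at h1
      rw [h1.resolve_right hz, zero_smul, add_zero]
      exact hw
    have := Submodule.eq_of_le_of_finrank_eq hmc (by rw [hm.1, hc2])
    exact hyf (hm.2 y (this ▸ hyc))
  · have hl := hS.isXLine_of_dirDeriv_eq_zero hp hp0 (hm.2 x hxm) hxp (hcker hxc)
    have h1 : Submodule.span F {p} ⊔ Submodule.span F {x} = c :=
      Submodule.eq_of_le_of_finrank_eq (sup_le
        ((Submodule.span_singleton_le_iff_mem _ _).2 hpc)
        ((Submodule.span_singleton_le_iff_mem _ _).2 hxc)) (by rw [hl.1, hc2])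
    exact hyf (hl.2 y (h1 ▸ hyc))

theorem finrank_inf_ker_dirDeriv (hS : IsTightSurface f t) (hb : Module.finrank F b = 3)
    (hno : ∀ m, IsXLine f m → ¬ m ≤ b) {p : Fin 4 → F} (hp : eval p f = 0) (hp0 : p ≠ 0) :
    Module.finrank F ↥(b ⊓ LinearMap.ker (dirDeriv f p)) = 2 := by
  have hker := hS.finrank_ker_dirDeriv hp hp0
  have h1 := Submodule.finrank_sup_add_finrank_inf_eq b (LinearMap.ker (dirDeriv f p))
  have h2 := Submodule.finrank_le (b ⊔ LinearMap.ker (dirDeriv f p))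
  rw [Module.finrank_fin_fun] at h2
  have h3 : Module.finrank F ↥(b ⊓ LinearMap.ker (dirDeriv f p)) < 3 := by
    rw [← hb]
    refine Submodule.finrank_lt_finrank_of_lt (lt_of_le_of_ne inf_le_left fun h => ?_)
    have h4 := Submodule.eq_of_le_of_finrank_eq (inf_eq_left.1 h) (by rw [hb, hker])
    obtain ⟨ℓ, hℓ, hpℓ⟩ := hS.exists_line_through hp
    exact hno ℓ hℓ (h4 ▸ fun v hv => hS.dirDeriv_eq_zero hℓ hpℓ hv)
  omega

theorem mem_span_of_dirDeriv_eq_zero (hS : IsTightSurface f t)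
    (hno : ∀ m, IsXLine f m → ¬ m ≤ b) {p x : Fin 4 → F} (hpb : p ∈ b) (hp : eval p f = 0)
    (hp0 : p ≠ 0) (hxb : x ∈ b) (hx : eval x f = 0) (h : dirDeriv f p x = 0) :
    x ∈ Submodule.span F {p} := by
  by_contra hxp
  exact hno _ (hS.isXLine_of_dirDeriv_eq_zero hp hp0 hx hxp h) (sup_le
    ((Submodule.span_singleton_le_iff_mem _ _).2 hpb)
    ((Submodule.span_singleton_le_iff_mem _ _).2 hxb))

theorem card_plane_nonzeros_tangent (hS : IsTightSurface f t) (hb : Module.finrank F b = 3)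
    (hno : ∀ m, IsXLine f m → ¬ m ≤ b) {p : Fin 4 → F} (hpb : p ∈ b) (hp : eval p f = 0)
    (hp0 : p ≠ 0) :
    (Finset.univ.filter fun x => (x ∈ b ∧ eval x f ≠ 0) ∧ dirDeriv f p x = 0).card =
      Fintype.card F ^ 2 - Fintype.card F := by
  obtain ⟨ℓ, hℓ, hpℓ⟩ := hS.exists_line_through hp
  have hpp : dirDeriv f p p = 0 := hS.dirDeriv_eq_zero hℓ hpℓ hpℓ
  have h1 := card_filter_mem_notMem (K := Submodule.span F {p})
    (L := b ⊓ LinearMap.ker (dirDeriv f p))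
    ((Submodule.span_singleton_le_iff_mem _ _).2 ⟨hpb, hpp⟩)
  rw [hS.finrank_inf_ker_dirDeriv hb hno hp hp0, finrank_span_singleton hp0, pow_one] at h1
  rw [← h1]
  congr 1
  ext x
  simp only [Finset.mem_filter, Finset.mem_univ, true_and, Submodule.mem_inf, LinearMap.mem_ker]
  constructor
  · rintro ⟨⟨h2, h3⟩, h4⟩
    refine ⟨⟨h2, h4⟩, fun h5 => h3 ?_⟩
    obtain ⟨r, rfl⟩ := Submodule.mem_span_singleton.1 h5
    exact hS.eval_smul hp r
  · rintro ⟨⟨h2, h4⟩, h5⟩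
    exact ⟨⟨h2, fun h3 => h5 (hS.mem_span_of_dirDeriv_eq_zero hno hpb hp hp0 h2 h3 h4)⟩, h4⟩

theorem card_plane_zeros (hS : IsTightSurface f t) (hb : Module.finrank F b = 3)
    (hno : ∀ m, IsXLine f m → ¬ m ≤ b) :
    (Finset.univ.filter fun x => (x ∈ b ∧ x ≠ 0) ∧ eval x f = 0).card =
      (Fintype.card F - 1) * (1 + t * Fintype.card F) := by
  obtain ⟨ℓ, hℓ⟩ := hS.exists_line
  have hq : 2 ≤ Fintype.card F := by have := hS.one_le; have := hS.lt_card; omega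
  obtain ⟨p, ⟨hpℓ, hpb⟩, hp0⟩ : ∃ p ∈ ℓ ⊓ b, p ≠ 0 := by
    refine (Submodule.ne_bot_iff _).1 fun h => ?_
    have h1 := Submodule.finrank_sup_add_finrank_inf_eq ℓ b
    have h2 := Submodule.finrank_le (ℓ ⊔ b)
    rw [h, finrank_bot, hℓ.1, hb] at h1
    rw [Module.finrank_fin_fun] at h2
    omega
  have hp := hℓ.2 p hpℓ
  have hpp : dirDeriv f p p = 0 := hS.dirDeriv_eq_zero hℓ hpℓ hpℓ
  set S := Finset.univ.filter fun x => x ∈ b ∧ x ∉ b ⊓ LinearMap.ker (dirDeriv f p) with hSdef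
  have hScard : S.card = Fintype.card F ^ 3 - Fintype.card F ^ 2 := by
    rw [hSdef, card_filter_mem_notMem inf_le_left, hb, hS.finrank_inf_ker_dirDeriv hb hno hp hp0]
  have hmemS : ∀ x, x ∈ S ↔ x ∈ b ∧ dirDeriv f p x ≠ 0 := fun x => by
    simp only [hSdef, Finset.mem_filter, Finset.mem_univ, true_and, Submodule.mem_inf,
      LinearMap.mem_ker]
    tauto
  have h1 := sum_card_filter_add_smul (S := S) (u := p) (fun v r => by
    rw [hmemS, hmemS, map_add, map_smul, hpp, smul_zero, add_zero,
      b.add_mem_iff_left (b.smul_mem r hpb)]) (fun x => eval x f = 0)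
  rw [Finset.sum_congr rfl fun e he => hS.card_filter_eval_add_smul hp ((hmemS e).1 he).2,
    Finset.sum_const, hScard, smul_eq_mul] at h1
  have h2 := Finset.card_filter_add_card_filter_not
    (s := Finset.univ.filter fun x => (x ∈ b ∧ x ≠ 0) ∧ eval x f = 0)
    (fun x => dirDeriv f p x = 0)
  have h3 : ((Finset.univ.filter fun x => (x ∈ b ∧ x ≠ 0) ∧ eval x f = 0).filter
      fun x => dirDeriv f p x = 0).card = Fintype.card F - 1 := by
    have h := card_filter_mem_ne_zero (Submodule.span F {p})
    rw [finrank_span_singleton hp0, pow_one] at h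
    rw [← h]
    congr 1
    ext x
    simp only [Finset.mem_filter, Finset.mem_univ, true_and]
    constructor
    · rintro ⟨⟨⟨h4, h5⟩, h6⟩, h7⟩
      exact ⟨hS.mem_span_of_dirDeriv_eq_zero hno hpb hp hp0 h4 h6 h7, h5⟩
    · rintro ⟨h4, h5⟩
      obtain ⟨r, rfl⟩ := Submodule.mem_span_singleton.1 h4
      exact ⟨⟨⟨b.smul_mem r hpb, h5⟩, hS.eval_smul hp r⟩, by rw [map_smul, hpp, smul_zero]⟩
  have h4 : ((Finset.univ.filter fun x => (x ∈ b ∧ x ≠ 0) ∧ eval x f = 0).filter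
      fun x => ¬ dirDeriv f p x = 0) = S.filter fun x => eval x f = 0 := by
    ext x
    simp only [Finset.mem_filter, Finset.mem_univ, true_and, hmemS]
    constructor
    · rintro ⟨⟨⟨h4, -⟩, h6⟩, h7⟩
      exact ⟨⟨h4, h7⟩, h6⟩
    · rintro ⟨⟨h4, h7⟩, h6⟩
      exact ⟨⟨⟨h4, fun h => h7 (by rw [h, map_zero])⟩, h6⟩, h7⟩
  rw [h3, h4] at h2
  rw [← h2]
  obtain ⟨r, hr⟩ : ∃ r, Fintype.card F = r + 1 := ⟨Fintype.card F - 1, by omega⟩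
  rw [hr] at h1 ⊢
  have h5 : (r + 1) ^ 3 - (r + 1) ^ 2 = (r + 1) * (r * (r + 1)) :=
    Nat.sub_eq_of_eq_add (by ring)
  rw [h5, mul_assoc] at h1
  rw [← Nat.eq_of_mul_eq_mul_left (by positivity) h1, Nat.add_sub_cancel]
  ring

theorem mul_card_tangent_le (hS : IsTightSurface f t) (hb : Module.finrank F b = 3)
    (hno : ∀ m, IsXLine f m → ¬ m ≤ b) {y : Fin 4 → F} (hyb : y ∈ b) (hy : eval y f ≠ 0) :
    t * (Finset.univ.filter fun x => ((x ∈ b ∧ x ≠ 0) ∧ eval x f = 0) ∧ dirDeriv f x y = 0).card ≤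
      (Fintype.card F - 1) * (Fintype.card F + t) := by
  have hq : 2 ≤ Fintype.card F := by have := hS.one_le; have := hS.lt_card; omega
  have hy0 : y ≠ 0 := by
    rintro rfl
    obtain ⟨ℓ, hℓ⟩ := hS.exists_line
    exact hy (hℓ.2 0 ℓ.zero_mem)
  set S := Finset.univ.filter fun x => x ∈ b ∧ x ∉ Submodule.span F {y} with hSdef
  have hmemS : ∀ x, x ∈ S ↔ x ∈ b ∧ x ∉ Submodule.span F {y} := fun x => by simp [hSdef]
  have hScard : S.card = Fintype.card F ^ 3 - Fintype.card F := by
    rw [hSdef, card_filter_mem_notMem ((Submodule.span_singleton_le_iff_mem _ _).2 hyb), hb,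
      finrank_span_singleton hy0, pow_one]
  have hinv : ∀ v (r : F), v + r • y ∈ S ↔ v ∈ S := fun v r => by
    rw [hmemS, hmemS, b.add_mem_iff_left (b.smul_mem r hyb),
      Submodule.add_mem_iff_left _ (Submodule.smul_mem _ r (Submodule.mem_span_singleton_self y))]
  have hspan : ∀ x, x ≠ 0 → eval x f = 0 → x ∉ Submodule.span F {y} := fun x hx0 hx h => by
    obtain ⟨r, rfl⟩ := Submodule.mem_span_singleton.1 h
    have hr : r ≠ 0 := fun h => hx0 (by rw [h, zero_smul])
    rw [eval_smul_of_isHomogeneous hS.hom] at hx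
    exact hy ((mul_eq_zero.1 hx).resolve_left (pow_ne_zero _ hr))
  obtain ⟨P, hP⟩ : ∃ P : (Fin 4 → F) → Prop, ∀ x, P x ↔ eval x f = 0 ∧ dirDeriv f x y = 0 :=
    ⟨_, fun _ => Iff.rfl⟩
  have hT := sum_card_filter_add_smul hinv P
  have hN := sum_card_filter_add_smul hinv (fun x => eval x f = 0)
  have hTeq : S.filter P =
      Finset.univ.filter fun x => ((x ∈ b ∧ x ≠ 0) ∧ eval x f = 0) ∧ dirDeriv f x y = 0 := by
    ext x
    simp only [Finset.mem_filter, Finset.mem_univ, true_and, hmemS, hP]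
    constructor
    · rintro ⟨⟨h1, h2⟩, h3, h4⟩
      exact ⟨⟨⟨h1, fun h => h2 (h ▸ Submodule.zero_mem _)⟩, h3⟩, h4⟩
    · rintro ⟨⟨⟨h1, h2⟩, h3⟩, h4⟩
      exact ⟨⟨h1, hspan x h2 h3⟩, h3, h4⟩
  have hNeq : S.filter (fun x => eval x f = 0) =
      Finset.univ.filter fun x => (x ∈ b ∧ x ≠ 0) ∧ eval x f = 0 := by
    ext x
    simp only [Finset.mem_filter, Finset.mem_univ, true_and, hmemS]
    constructor
    · rintro ⟨⟨h1, h2⟩, h3⟩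
      exact ⟨⟨h1, fun h => h2 (h ▸ Submodule.zero_mem _)⟩, h3⟩
    · rintro ⟨⟨h1, h2⟩, h3⟩
      exact ⟨⟨h1, hspan x h2 h3⟩, h3⟩
  rw [hTeq] at hT
  rw [hNeq, hS.card_plane_zeros hb hno] at hN
  have hle : ∀ v ∈ S,
      t * (Finset.univ.filter fun r : F => P (v + r • y)).card +
      (Finset.univ.filter fun r : F => eval (v + r • y) f = 0).card ≤ t + 1 := by
    intro v hv
    by_cases hex : ∃ r : F, P (v + r • y)
    · obtain ⟨r, hPr⟩ := hex
      obtain ⟨hr, hrD⟩ := (hP _).1 hPr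
      have hvS := (hmemS _).1 ((hinv v r).2 hv)
      have hr0 : v + r • y ≠ 0 := fun h => hvS.2 (h ▸ Submodule.zero_mem _)
      have h1 : ∀ s : F, eval (v + s • y) f = 0 → s = r := fun s hs => by
        by_contra hne
        obtain ⟨ℓ, hℓ, hvℓ⟩ := hS.exists_line_through hr
        have h2 : v + s • y = (v + r • y) + (s - r) • y := by rw [sub_smul]; abel
        have h3 : dirDeriv f (v + r • y) (v + s • y) = 0 := by
          rw [h2, map_add, hS.dirDeriv_eq_zero hℓ hvℓ hvℓ, map_smul, hrD, smul_zero, add_zero]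
        have h4 := hS.mem_span_of_dirDeriv_eq_zero hno hvS.1 hr hr0
          ((hmemS _).1 ((hinv v s).2 hv)).1 hs h3
        have h5 : (s - r) • y ∈ Submodule.span F {v + r • y} := by
          have := Submodule.sub_mem _ h4 (Submodule.mem_span_singleton_self (v + r • y))
          rwa [h2, add_sub_cancel_left] at this
        have h6 := (Submodule.smul_mem_iff _ (sub_ne_zero.2 hne)).1 h5
        obtain ⟨c, hc⟩ := Submodule.mem_span_singleton.1 h6
        exact hy (hc ▸ hS.eval_smul hr c)
      have h2 : (Finset.univ.filter fun r : F => eval (v + r • y) f = 0).card ≤ 1 :=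
        Finset.card_le_one.2 fun s hs s' hs' => by
          rw [h1 s (Finset.mem_filter.1 hs).2, h1 s' (Finset.mem_filter.1 hs').2]
      have h3 : (Finset.univ.filter fun r : F => P (v + r • y)).card ≤ 1 :=
        (Finset.card_le_card fun s hs => by
          simp only [Finset.mem_filter, Finset.mem_univ, true_and, hP] at hs ⊢
          exact hs.1).trans h2
      have h4 := Nat.mul_le_mul_left t h3
      omega
    · push Not at hex
      rw [Finset.filter_false_of_mem fun s _ => hex s, Finset.card_empty, mul_zero,
        zero_add]
      have hne : linePoly f v y ≠ 0 := fun h => hy <| by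
        rw [← coeff_linePoly_of_isHomogeneous hS.hom v y, h, Polynomial.coeff_zero]
      have h1 := card_zeros_le_natDegree hne
      simp only [eval_linePoly] at h1
      exact h1.trans ((natDegree_linePoly_le f v y).trans hS.hom.totalDegree_le)
  have h := Finset.sum_le_sum hle
  rw [Finset.sum_add_distrib, ← Finset.mul_sum, hT, hN, Finset.sum_const, hScard,
    smul_eq_mul] at h
  obtain ⟨r, hr⟩ : ∃ r, Fintype.card F = r + 1 := ⟨Fintype.card F - 1, by omega⟩
  rw [hr] at h ⊢
  have h5 : (r + 1) ^ 3 - (r + 1) = (r + 1) * (r * (r + 2)) :=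
    Nat.sub_eq_of_eq_add (by ring)
  rw [h5, Nat.add_sub_cancel] at h
  rw [Nat.add_sub_cancel]
  refine Nat.le_of_mul_le_mul_left ?_ (by positivity : 0 < r + 1)
  nlinarith

theorem sq_le_card (hS : IsTightSurface f t) : t ^ 2 ≤ Fintype.card F := by
  have hq := hS.lt_card
  have ht := hS.one_le
  obtain ⟨b, hb, hno⟩ := hS.exists_plane_without_line
  have hK := hS.card_plane_zeros hb hno
  set K := Finset.univ.filter fun x => (x ∈ b ∧ x ≠ 0) ∧ eval x f = 0 with hKdef
  set Q := Finset.univ.filter fun x => x ∈ b ∧ eval x f ≠ 0 with hQdef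
  have hQ : Q.card + K.card + 1 = Fintype.card F ^ 3 := by
    have h1 := Finset.card_filter_add_card_filter_not
      (s := Finset.univ.filter fun x => x ∈ b ∧ x ≠ 0) (fun x => eval x f = 0)
    rw [card_filter_mem_ne_zero, hb, Finset.filter_filter, Finset.filter_filter, ← hKdef] at h1
    have h2 : (Finset.univ.filter fun x => (x ∈ b ∧ x ≠ 0) ∧ ¬ eval x f = 0) = Q := by
      ext x
      simp only [hQdef, Finset.mem_filter, Finset.mem_univ, true_and]
      refine ⟨fun h => ⟨h.1.1, h.2⟩, fun h => ⟨⟨h.1, ?_⟩, h.2⟩⟩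
      rintro rfl
      obtain ⟨ℓ, hℓ⟩ := hS.exists_line
      exact h.2 (hℓ.2 0 ℓ.zero_mem)
    rw [h2] at h1
    have := Nat.one_le_pow 3 (Fintype.card F) (by omega)
    omega
  have hsum := Finset.sum_card_bipartiteAbove_eq_sum_card_bipartiteBelow (s := K) (t := Q)
    (fun x y => dirDeriv f x y = 0)
  have h1 : ∀ x ∈ K, (Finset.bipartiteAbove (fun x y => dirDeriv f x y = 0) Q x).card =
      Fintype.card F ^ 2 - Fintype.card F := fun x hx => by
    obtain ⟨⟨hxb, hx0⟩, hx⟩ := (Finset.mem_filter.1 hx).2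
    rw [Finset.bipartiteAbove, hQdef, Finset.filter_filter]
    exact hS.card_plane_nonzeros_tangent hb hno hxb hx hx0
  have h2 : ∀ y ∈ Q, t * (Finset.bipartiteBelow (fun x y => dirDeriv f x y = 0) K y).card ≤
      (Fintype.card F - 1) * (Fintype.card F + t) := fun y hy => by
    obtain ⟨hyb, hy⟩ := (Finset.mem_filter.1 hy).2
    rw [Finset.bipartiteBelow, hKdef, Finset.filter_filter]
    exact hS.mul_card_tangent_le hb hno hyb hy
  have h3 := Finset.sum_le_sum h2
  rw [← Finset.mul_sum, ← hsum, Finset.sum_congr rfl h1, Finset.sum_const, Finset.sum_const,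
    smul_eq_mul, smul_eq_mul, hK] at h3
  rw [hK] at hQ
  obtain ⟨r, hr⟩ : ∃ r, Fintype.card F = r + 1 := ⟨Fintype.card F - 1, by omega⟩
  rw [hr] at h3 hQ hq ⊢
  have h5 : (r + 1) ^ 2 - (r + 1) = r * (r + 1) := Nat.sub_eq_of_eq_add (by ring)
  rw [h5, Nat.add_sub_cancel] at h3
  rw [Nat.add_sub_cancel] at hQ
  have hr0 : 1 ≤ r := by omega
  have hQ' : (Q.card : ℤ) = r * ((r + 1) * (r + 2 - t)) := by
    have : (Q.card : ℤ) + r * (1 + t * (r + 1)) + 1 = (r + 1) ^ 3 := by exact_mod_cast hQ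
    linear_combination this
  have h6 : (t : ℤ) * (r * (1 + t * (r + 1)) * (r * (r + 1))) ≤
      Q.card * (r * (r + 1 + t)) := by exact_mod_cast h3
  rw [hQ'] at h6
  have h7 : (0 : ℤ) < r * r * (r + 1) := by positivity
  have h8 : ((r : ℤ) * r * (r + 1)) * (t * (1 + t * (r + 1))) ≤
      (r * r * (r + 1)) * ((r + 2 - t) * (r + 1 + t)) := by linarith
  have h9 := le_of_mul_le_mul_left h8 h7
  have h10 : ((r : ℤ) + 2) * t ^ 2 ≤ (r + 2) * (r + 1) := by linarith
  have h11 := le_of_mul_le_mul_left h10 (by positivity)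
  exact_mod_cast h11

theorem eq_one_or_card_eq_sq (hS : IsTightSurface f t) : t = 1 ∨ Fintype.card F = t ^ 2 := by
  by_cases ht : t = 1
  · exact Or.inl ht
  · have := hS.one_le
    exact Or.inr (le_antisymm (hS.card_le_sq (by omega)) hS.sq_le_card)

end IsTightSurface

end PlaneSection

section Reduction

open MvPolynomial
open scoped Classical

variable {F : Type*} [Field F] [Fintype F] {m : ℕ}
  {f : MvPolynomial (Fin m) F} {t k : ℕ} {L : Submodule F (Fin m → F)}

theorem exists_independent_mod {F V : Type*} [Field F] [AddCommGroup V] [Module F V]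
    [FiniteDimensional F V] {L : Submodule F V} (hL : Module.finrank F L + 2 ≤ Module.finrank F V) :
    ∃ e₁ e₂ : V, ∀ α β : F, α • e₁ + β • e₂ ∈ L → α = 0 ∧ β = 0 := by
  have hex : ∀ K : Submodule F V, Module.finrank F K < Module.finrank F V → ∃ e, e ∉ K := by
    intro K hK
    by_contra! h
    rw [(Submodule.eq_top_iff').2 h, finrank_top] at hK
    exact lt_irrefl _ hK
  obtain ⟨e₁, h₁⟩ := hex L (by omega)
  obtain ⟨e₂, h₂⟩ := hex (L ⊔ Submodule.span F {e₁})
    (by rw [finrank_sup_span_singleton h₁]; omega)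
  refine ⟨e₁, e₂, fun α β h => ?_⟩
  have hβ : β = 0 := by
    by_contra hβ
    refine h₂ ((Submodule.smul_mem_iff _ hβ).1 ?_)
    have h3 := Submodule.sub_mem _ (Submodule.mem_sup_left h)
      (Submodule.mem_sup_right (S := L)
        (Submodule.smul_mem _ α (Submodule.mem_span_singleton_self e₁)))
    rwa [add_sub_cancel_left] at h3
  subst hβ
  refine ⟨?_, rfl⟩
  by_contra hα
  rw [zero_smul, add_zero] at h
  exact h₁ ((L.smul_mem_iff hα).1 h)

theorem exists_vertex_decomposition (hf : f.IsHomogeneous (t + 1)) (ht : 1 ≤ t)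
    (htq : t + 1 ≤ Fintype.card F) (hk : Module.finrank F L = k + 1 + 1) (hm : k + 4 ≤ m)
    (hL : ∀ v ∈ L, eval v f = 0)
    (htight : ∀ e ∉ L, (cosetZeros f L e).card = t * Fintype.card F ^ (k + 1)) :
    ∃ C ≤ L, ∃ a ∈ L, ∃ b ∈ L, ∃ e₁ e₂ : Fin m → F, Module.finrank F C = k ∧
      (∀ r s : F, r • a + s • b ∈ C → r = 0 ∧ s = 0) ∧
      (∀ w ∈ L, ∃ r s : F, w - (r • a + s • b) ∈ C) ∧
      (∀ α β : F, α • e₁ + β • e₂ ∈ L → α = 0 ∧ β = 0) ∧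
      ∀ α β : F, ∀ w ∈ L, ∀ c ∈ C, eval (α • e₁ + β • e₂ + w) f = 0 →
        eval (α • e₁ + β • e₂ + w + c) f = 0 := by
  obtain ⟨e₁, e₂, hind⟩ := exists_independent_mod (L := L)
    (by rw [hk, Module.finrank_fin_fun]; omega)
  have hstr : ∀ e ∉ L, _ := fun e he => coset_structure hf ht htq hk hL (htight e he)
  have he₁ : e₁ ∉ L := fun h => one_ne_zero (hind 1 0 (by simpa using h)).1
  have he₂ : e₂ ∉ L := fun h => one_ne_zero (hind 0 1 (by simpa using h)).2
  obtain ⟨M₁, hM₁L, hM₁, -, hD₁⟩ := hstr e₁ he₁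
  obtain ⟨M₂, hM₂L, hM₂, -, hD₂⟩ := hstr e₂ he₂
  have hcomb : ∀ p, dirDeriv f p e₁ = 0 → dirDeriv f p e₂ = 0 → ∀ α β : F,
      dirDeriv f p (α • e₁ + β • e₂) = 0 := fun p h1 h2 α β => by
    rw [map_add, map_smul, map_smul, h1, h2, smul_zero, smul_zero, add_zero]
  have hne : M₁ ≠ M₂ := by
    rintro rfl
    obtain ⟨p, hpL, hpM⟩ : ∃ p ∈ L, p ∉ M₁ := by
      refine SetLike.not_le_iff_exists.1 fun h => ?_
      have := Submodule.finrank_mono h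
      omega
    have hp₁ : dirDeriv f p e₁ ≠ 0 := fun h => hpM ((hD₁ p hpL).1 h)
    have heL : dirDeriv f p e₂ • e₁ + (-dirDeriv f p e₁) • e₂ ∉ L := fun h =>
      hp₁ (neg_eq_zero.1 (hind _ _ h).2)
    obtain ⟨M, hML, hM, -, hD⟩ := hstr _ heL
    have h1 : M₁ ≤ M := fun c hc => by
      have hcL := hM₁L hc
      exact (hD c hcL).1 (hcomb c ((hD₁ c hcL).2 hc) ((hD₂ c hcL).2 hc) _ _)
    have h2 := Submodule.eq_of_le_of_finrank_eq h1 (by rw [hM₁, hM])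
    refine hpM (h2 ▸ (hD p hpL).1 ?_)
    simp only [map_add, map_smul, smul_eq_mul]
    ring
  have hnot : ∀ {K K' : Submodule F (Fin m → F)}, Module.finrank F K = k + 1 →
      Module.finrank F K' = k + 1 → K ≠ K' → ∃ a ∈ K, a ∉ K' := fun hK hK' h =>
    SetLike.not_le_iff_exists.1 fun hle =>
      h (Submodule.eq_of_le_of_finrank_eq hle (by rw [hK, hK']))
  obtain ⟨a, ha₁, ha₂⟩ := hnot hM₁ hM₂ hne
  obtain ⟨b, hb₂, hb₁⟩ := hnot hM₂ hM₁ hne.symm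
  have hC : Module.finrank F ↥(M₁ ⊓ M₂) = k := by
    have h1 := Submodule.finrank_sup_add_finrank_inf_eq M₁ M₂
    have h2 := Submodule.finrank_mono (sup_le hM₁L hM₂L)
    have h3 : M₂ < M₁ ⊔ M₂ := lt_of_le_of_ne le_sup_right fun h =>
      ha₂ (h ▸ Submodule.mem_sup_left ha₁)
    have h4 := Submodule.finrank_lt_finrank_of_lt h3
    omega
  refine ⟨M₁ ⊓ M₂, inf_le_left.trans hM₁L, a, hM₁L ha₁, b, hM₂L hb₂, e₁, e₂, hC,
    fun r s h => ?_, fun w hw => ?_, hind, fun α β w hw c hc h => ?_⟩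
  · refine ⟨?_, ?_⟩
    · by_contra hr
      exact ha₂ ((M₂.smul_mem_iff hr).1 ((M₂.add_mem_iff_left (M₂.smul_mem s hb₂)).1 h.2))
    · by_contra hs
      exact hb₁ ((M₁.smul_mem_iff hs).1 ((M₁.add_mem_iff_right (M₁.smul_mem r ha₁)).1 h.1))
  · obtain ⟨r, hr⟩ := exists_sub_smul_mem_of_finrank hM₂L hM₂ hk (hM₁L ha₁) ha₂ hw
    obtain ⟨s, hs⟩ := exists_sub_smul_mem_of_finrank (inf_le_right : M₁ ⊓ M₂ ≤ M₂) hC hM₂ hb₂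
      (fun h => hb₁ h.1) hr
    exact ⟨r, s, by rwa [← sub_sub]⟩
  · by_cases he : α • e₁ + β • e₂ ∈ L
    · exact hL _ (L.add_mem (L.add_mem he hw) (hM₁L hc.1))
    · obtain ⟨M, hML, -, hinv, hD⟩ := hstr _ he
      have hcL := hM₁L hc.1
      exact hinv w hw h c ((hD c hcL).1 (hcomb c ((hD₁ c hcL).2 hc.1) ((hD₂ c hcL).2 hc.2) _ _))

theorem isTightSurface_of_line {g : MvPolynomial (Fin 4) F} (hg : g.IsHomogeneous (t + 1))
    (ht : 1 ≤ t) (htq : t + 1 ≤ Fintype.card F)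
    (hplane : ∀ U : Submodule F (Fin 4 → F), Module.finrank F U = 3 → ¬ ∀ v ∈ U, eval v g = 0)
    {ℓ : Submodule F (Fin 4 → F)} (hℓ : IsXLine g ℓ)
    (htight : ∀ e ∉ ℓ, (cosetZeros g ℓ e).card = t * Fintype.card F) : IsTightSurface g t := by
  refine ⟨hg, ht, htq, ⟨ℓ, hℓ⟩, hplane, fun l hl => ?_⟩
  have h1 := tight_iff_card (k := 1) hg ht htq hℓ.1 hℓ.2 hplane
  have h2 := tight_iff_card (k := 1) hg ht htq hl.1 hl.2 hplane
  have h3 := card_filter_zeros_eq hℓ.2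
  rw [card_filter_zeros_eq hl.2, hℓ.1, hl.1] at h3
  rw [← Nat.add_right_cancel h3] at h1
  simp only [pow_one] at h1 h2
  exact h2.2 (h1.1 htight)

theorem exists_isTightSurface (hf : f.IsHomogeneous (t + 1)) (ht : 1 ≤ t)
    (htq : t + 1 ≤ Fintype.card F) (hk : Module.finrank F L = k + 1 + 1) (hm : k + 4 ≤ m)
    (hL : ∀ v ∈ L, eval v f = 0)
    (hbig : ∀ U : Submodule F (Fin m → F), Module.finrank F U = k + 3 → ¬ ∀ v ∈ U, eval v f = 0)
    (htight : ∀ e ∉ L, (cosetZeros f L e).card = t * Fintype.card F ^ (k + 1)) :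
    ∃ g : MvPolynomial (Fin 4) F, IsTightSurface g t := by
  obtain ⟨C, hCL, a, ha, b, hb, e₁, e₂, hC, hab, hsplit, hind, hinv⟩ :=
    exists_vertex_decomposition hf ht htq hk hm hL htight
  set A : (Fin 4 → F) →ₗ[F] (Fin m → F) := Fintype.linearCombination F ![a, b, e₁, e₂] with hA
  have hAapp : ∀ y, A y = y 2 • e₁ + y 3 • e₂ + (y 0 • a + y 1 • b) := fun y => by
    simp only [hA, Fintype.linearCombination_apply, Fin.sum_univ_four]
    simp
    abel
  have habL : ∀ y : Fin 4 → F, y 0 • a + y 1 • b ∈ L := fun y =>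
    L.add_mem (L.smul_mem _ ha) (L.smul_mem _ hb)
  have heval : ∀ y, eval y (affPull f 0 ![a, b, e₁, e₂]) = eval (A y) f := fun y => by
    rw [eval_affPull, zero_add, hA, Fintype.linearCombination_apply]
  have hAL : ∀ y, A y ∈ L ↔ y 2 = 0 ∧ y 3 = 0 := fun y => by
    rw [hAapp, L.add_mem_iff_left (habL y)]
    refine ⟨hind _ _, fun h => ?_⟩
    rw [h.1, h.2, zero_smul, zero_smul, add_zero]
    exact L.zero_mem
  have hAC : ∀ y, A y ∈ C → y = 0 := fun y hy => by
    obtain ⟨h2, h3⟩ := (hAL y).1 (hCL hy)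
    rw [hAapp, h2, h3, zero_smul, zero_smul, add_zero, zero_add] at hy
    obtain ⟨h0, h1⟩ := hab _ _ hy
    ext i
    fin_cases i <;> assumption
  have hAinj : Function.Injective A := (injective_iff_map_eq_zero A).2 fun y hy =>
    hAC y (hy ▸ C.zero_mem)
  have hAinv : ∀ y, ∀ c ∈ C, eval (A y) f = 0 → eval (A y + c) f = 0 := fun y c hc h => by
    rw [hAapp] at h ⊢
    exact hinv _ _ _ (habL y) c hc h
  have hline : Module.finrank F ↥(L.comap A) = 2 := by
    have h0 : L.comap A = Submodule.span F {Pi.single 0 1} ⊔ Submodule.span F {Pi.single 1 1} := by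
      ext y
      rw [Submodule.mem_comap, hAL, Submodule.mem_sup]
      constructor
      · rintro ⟨h2, h3⟩
        refine ⟨_, Submodule.mem_span_singleton.2 ⟨y 0, rfl⟩, _,
          Submodule.mem_span_singleton.2 ⟨y 1, rfl⟩, ?_⟩
        ext i
        fin_cases i <;> simp [h2, h3]
      · rintro ⟨u, hu, v, hv, rfl⟩
        obtain ⟨r, rfl⟩ := Submodule.mem_span_singleton.1 hu
        obtain ⟨s, rfl⟩ := Submodule.mem_span_singleton.1 hv
        simp
    rw [h0, finrank_sup_span_singleton, finrank_span_singleton]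
    · simp
    · rw [Submodule.mem_span_singleton]
      rintro ⟨r, hr⟩
      have := congrFun hr 1
      simp at this
  refine ⟨affPull f 0 ![a, b, e₁, e₂], isTightSurface_of_line (ℓ := L.comap A)
    (isHomogeneous_affPull hf _) ht htq (fun U hU hzero => ?_)
    ⟨hline, fun v hv => by rw [heval]; exact hL _ hv⟩ fun e he => ?_⟩
  · refine hbig (U.map A ⊔ C) ?_ fun v hv => ?_
    · have h1 := Submodule.finrank_sup_add_finrank_inf_eq (U.map A) C
      have h2 : U.map A ⊓ C = ⊥ := by
        refine (Submodule.eq_bot_iff _).2 ?_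
        rintro _ ⟨⟨y, -, rfl⟩, hy⟩
        rw [hAC y hy, map_zero]
      rw [h2, finrank_bot, hC, (Submodule.equivMapOfInjective A hAinj U).finrank_eq.symm.trans hU] at h1
      omega
    · obtain ⟨_, ⟨y, hy, rfl⟩, c, hc, rfl⟩ := Submodule.mem_sup.1 hv
      exact hAinv y c hc (by rw [← heval]; exact hzero y hy)
  · have h1 := htight (A e) he
    have h2 := card_filter_mem_submodule C
    rw [hC] at h2
    refine Nat.eq_of_mul_eq_mul_right (pow_pos (Fintype.card_pos (α := F)) k) ?_
    rw [mul_assoc, ← pow_succ', ← h1, ← h2, ← Finset.card_product]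
    refine Finset.card_bij (fun x _ => A x.1 + x.2) (fun x hx => ?_) (fun x hx y hy h => ?_)
      (fun w hw => ?_)
    · simp only [Finset.mem_product, Finset.mem_filter, Finset.mem_univ, true_and,
        mem_cosetZeros, heval] at hx
      refine mem_cosetZeros.2 ⟨L.add_mem hx.1.1 (hCL hx.2), ?_⟩
      rw [← add_assoc, ← map_add]
      exact hAinv _ _ hx.2 hx.1.2
    · simp only [Finset.mem_product, Finset.mem_filter, Finset.mem_univ, true_and] at hx hy
      have h3 : x.1 - y.1 = 0 := hAC _ <| by
        have : A (x.1 - y.1) = y.2 - x.2 := by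
          rw [map_sub, sub_eq_sub_iff_add_eq_add, h, add_comm]
        rw [this]
        exact C.sub_mem hy.2 hx.2
      have h4 := sub_eq_zero.1 h3
      refine Prod.ext h4 ?_
      rw [h4] at h
      exact add_left_cancel h
    · obtain ⟨hwL, hw⟩ := mem_cosetZeros.1 hw
      obtain ⟨r, s, hrs⟩ := hsplit w hwL
      have hA0 : A ![r, s, 0, 0] = r • a + s • b := by
        rw [hAapp]; simp
      refine ⟨(![r, s, 0, 0], w - (r • a + s • b)), ?_, by rw [hA0, add_sub_cancel]⟩
      simp only [Finset.mem_product, Finset.mem_filter, Finset.mem_univ, true_and,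
        mem_cosetZeros, heval]
      refine ⟨⟨by rw [Submodule.mem_comap, hAL]; simp, ?_⟩, hrs⟩
      have h3 : A e + w = A (e + ![r, s, 0, 0]) + (w - (r • a + s • b)) := by
        rw [map_add, hA0]; abel
      have h4 : A (e + ![r, s, 0, 0]) = A e + w + -(w - (r • a + s • b)) := by
        rw [map_add, hA0]; abel
      have h5 : A e + w = (e 2) • e₁ + e 3 • e₂ + ((e 0 • a + e 1 • b) + w) := by
        rw [hAapp]; abel
      rw [h4, h5]
      rw [h5] at hw
      exact hinv _ _ _ (L.add_mem (habL e) hwL) _ (C.neg_mem hrs) hw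

end Reduction

section Main

open MvPolynomial
open scoped Classical

theorem numPoints_le_NP {F : Type*} [Field F] [Fintype F] {n : ℕ}
    (f : MvPolynomial (Fin (n + 1)) F) : numPoints f ≤ NP (Fintype.card F) n := by
  have h := Projectivization.card_of_finrank F (Fin (n + 1) → F) (n := n + 1) (by simp)
  rw [Nat.card_eq_fintype_card (α := F)] at h
  rw [NP, ← h, numPoints]
  exact Nat.card_le_card_of_injective _ Subtype.val_injective

theorem NP_lt_Theta {q d n k : ℕ} (hq : 1 ≤ q) (hkn : k ≤ n) (hd : q + 2 ≤ d) :
    NP q (n + 1) < Theta q d n k := by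
  have h1 : NP q (n + 1) = NP q k + q ^ (k + 1) * NP q (n - k) := by
    rw [NP, show n + 1 + 1 = (k + 1) + (n - k + 1) by omega, Finset.sum_range_add, NP, NP,
      Finset.mul_sum]
    simp only [pow_add]
  have h2 : 0 < q ^ k * NP q (n - k) := by
    refine Nat.mul_pos (pow_pos hq _) (Finset.sum_pos (fun i _ => pow_pos hq _) (by simp))
  have h3 : (q + 1) * (q ^ k * NP q (n - k)) ≤ (d - 1) * (q ^ k * NP q (n - k)) :=
    Nat.mul_le_mul_right _ (by omega)
  rw [h1, Theta, mul_assoc, pow_succ]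
  nlinarith

end Main

theorem stmt11 {F : Type*} [Field F] [Fintype F] {n d k : ℕ}
    (hn : 1 ≤ n) (hd : 2 ≤ d) (hk1 : 0 < k) (hkn : k ≤ n - 1)
    (f : MvPolynomial (Fin (n + 2)) F) (hf0 : f ≠ 0) (hsq : Squarefree f)
    (hhom : f.IsHomogeneous d) (hthas : ThasEq f k)
    (heq : numPoints f = Theta (Fintype.card F) d n k) :
    d = 2 ∨ d = Fintype.card F + 1 ∨ ∃ s : ℕ, Fintype.card F = s ^ 2 ∧ d = s + 1 := by
  obtain ⟨⟨L, hLk, hL⟩, hbig⟩ := hthas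
  have hbig' : ∀ U : Submodule F (Fin (n + 2) → F), Module.finrank F U = k + 2 →
      ¬ ∀ v ∈ U, MvPolynomial.eval v f = 0 := fun U hU h => hbig ⟨U, hU, h⟩
  obtain ⟨t, rfl⟩ : ∃ t, d = t + 1 := ⟨d - 1, by omega⟩
  obtain ⟨j, rfl⟩ : ∃ j, k = j + 1 := ⟨k - 1, by omega⟩
  rcases lt_trichotomy (t + 1) (Fintype.card F + 1) with h | h | h
  · have htight : ∀ e ∉ L, (cosetZeros f L e).card = t * Fintype.card F ^ (j + 1) :=
      fun e he => tight_of_numPoints hhom (by omega) (by omega) hLk (by omega) hL hbig' heq he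
    obtain ⟨g, hg⟩ := exists_isTightSurface hhom (by omega) (by omega) hLk (by omega) hL hbig' htight
    rcases hg.eq_one_or_card_eq_sq with h1 | h1
    · exact Or.inl (by omega)
    · exact Or.inr (Or.inr ⟨t, h1, rfl⟩)
  · exact Or.inr (Or.inl h)
  · have h1 := numPoints_le_NP f
    have h2 := NP_lt_Theta (q := Fintype.card F) (d := t + 1) (n := n) (k := j + 1)
      Fintype.card_pos (by omega) (by omega)
    omega
end

section
/- Let q = s^2 be a square prime power and h ≥ 1 an integer, and let X_H ⊂ P^{2h+1} be the nonsingular Hermitian hypersurface over F_q defined by X_0^{s+1} + X_1^{s+1} + … + X_{2h+1}^{s+1} = 0. Then the Thas invariant of X_H equals h and N_q(X_H) = (s·q^h + 1)·N_q(P^h) = s·q^h·N_q(P^h) + N_q(P^h) = Θ_{2h,h}^{s+1,q}. -/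
section HermitianForm

variable {F : Type*} [Field F] [Fintype F] {s : ℕ}

theorem two_le_of_card_eq_sq (hq : Fintype.card F = s ^ 2) : 2 ≤ s := by
  have h1 : 1 < Fintype.card F := Fintype.one_lt_card
  by_contra h
  have : s = 0 ∨ s = 1 := by omega
  rcases this with rfl | rfl <;> simp [hq] at h1

theorem exists_ringHom_pow (hq : Fintype.card F = s ^ 2) :
    ∃ σ : F →+* F, ∀ x, σ x = x ^ s := by
  obtain ⟨p, hc, n, hp, hn⟩ := FiniteField.card' F
  have hs : s ∣ p ^ (n : ℕ) := by rw [← hn, hq, sq]; exact dvd_mul_right s s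
  obtain ⟨k, -, rfl⟩ := (Nat.dvd_prime_pow hp).mp hs
  have : Fact p.Prime := ⟨hp⟩
  exact ⟨iterateFrobenius F p k, fun x => iterateFrobenius_def p k x⟩

theorem pow_pow_of_card_eq_sq (hq : Fintype.card F = s ^ 2) (x : F) : (x ^ s) ^ s = x := by
  rw [← pow_mul, ← sq, ← hq, FiniteField.pow_card]

/-- The norm map to the subfield of order `s` has fibres of size `s + 1` over nonzero elements. -/
theorem card_norm_fiber (hq : Fintype.card F = s ^ 2) {c : F} (hc : c ≠ 0) (hcs : c ^ s = c) :
    Nat.card {y : F // y ^ (s + 1) = c} = s + 1 := by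
  classical
  obtain ⟨t, rfl⟩ : ∃ t, s = t + 1 := ⟨s - 1, by have := two_le_of_card_eq_sq hq; omega⟩
  have ht : 0 < t := by have := two_le_of_card_eq_sq hq; omega
  obtain ⟨g, hg⟩ := IsCyclic.exists_generator (α := Fˣ)
  have hord : orderOf g = t * (t + 2) := by
    rw [orderOf_eq_card_of_forall_mem_zpowers hg, Nat.card_eq_fintype_card, Fintype.card_units, hq]
    have : (t + 1) ^ 2 = t * (t + 2) + 1 := by ring
    omega
  have hζ' : IsPrimitiveRoot (g ^ t) (t + 2) := by
    rw [IsPrimitiveRoot.iff_orderOf, orderOf_pow_of_dvd ht.ne' (by rw [hord]; exact dvd_mul_right _ _),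
      hord, Nat.mul_div_cancel_left _ ht]
  have hζ : IsPrimitiveRoot ((g ^ t : Fˣ) : F) (t + 2) :=
    hζ'.map_of_injective (f := Units.coeHom F) Units.val_injective
  have hex : ∃ α : F, α ^ (t + 2) = c := by
    obtain ⟨k, hk⟩ := (mem_powers_iff_mem_zpowers (x := g)).mpr (hg (Units.mk0 c hc))
    have hk : g ^ k = Units.mk0 c hc := hk
    have h1 : g ^ (t * k) = 1 := by
      rw [mul_comm, pow_mul, hk]
      ext
      have : c * c ^ t = c * 1 := by rw [mul_one, ← pow_succ']; exact hcs
      simpa using mul_left_cancel₀ hc this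
    have h2 := orderOf_dvd_of_pow_eq_one h1
    rw [hord] at h2
    obtain ⟨j, rfl⟩ := Nat.dvd_of_mul_dvd_mul_left ht h2
    refine ⟨((g ^ j : Fˣ) : F), ?_⟩
    have := congrArg (Units.val) hk
    rw [Units.val_mk0] at this
    rw [← this, ← Units.val_pow_eq_pow_val, ← pow_mul, mul_comm]
  have hcard := hζ.card_nthRoots c
  rw [if_pos hex] at hcard
  have hfin : (Polynomial.nthRootsFinset (t + 2) c).card = t + 2 := by
    rw [Polynomial.nthRootsFinset_def, Multiset.toFinset_card_of_nodup (hζ.nthRoots_nodup hc), hcard]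
  rw [← Nat.card_congr (Equiv.subtypeEquivRight (p := fun y => y ∈ Polynomial.nthRootsFinset (t + 2) c)
    fun y => Polynomial.mem_nthRootsFinset (by omega) c), Nat.card_eq_fintype_card,
    Fintype.card_coe, hfin]

theorem sum_norm_pow (hq : Fintype.card F = s ^ 2) {ι : Type*} [Fintype ι] (x : ι → F) :
    (-∑ i, x i ^ (s + 1)) ^ s = -∑ i, x i ^ (s + 1) := by
  obtain ⟨σ, hσ⟩ := exists_ringHom_pow hq
  rw [← hσ, map_neg, map_sum]
  congr 1
  refine Finset.sum_congr rfl fun i _ => ?_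
  rw [hσ, pow_succ, mul_pow, pow_pow_of_card_eq_sq hq, mul_comm]

/-- The number of zeros in affine space of the Hermitian form in `m` variables. -/
noncomputable def hermitianZeros (F : Type*) [Field F] (s m : ℕ) : ℕ :=
  Nat.card {x : Fin m → F // ∑ i, x i ^ (s + 1) = 0}

theorem hermitianZeros_zero : hermitianZeros F s 0 = 1 := by
  simp [hermitianZeros]

theorem hermitianZeros_succ (hq : Fintype.card F = s ^ 2) (m : ℕ) :
    hermitianZeros F s (m + 1) + s * hermitianZeros F s m = (s + 1) * (s ^ 2) ^ m := by
  classical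
  let e : {x : Fin (m + 1) → F // ∑ i, x i ^ (s + 1) = 0} ≃
      Σ x : Fin m → F, {y : F // y ^ (s + 1) = -∑ i, x i ^ (s + 1)} :=
    { toFun := fun x => ⟨Fin.tail x.1, x.1 0, by
        have := x.2
        rw [Fin.sum_univ_succ] at this
        exact eq_neg_of_add_eq_zero_left this⟩
      invFun := fun z => ⟨Fin.cons z.2.1 z.1, by
        rw [Fin.sum_univ_succ]
        simp [z.2.2]⟩
      left_inv := fun x => by simp
      right_inv := fun z => rfl }
  have hfib (x : Fin m → F) : Nat.card {y : F // y ^ (s + 1) = -∑ i, x i ^ (s + 1)} +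
      s * (if ∑ i, x i ^ (s + 1) = 0 then 1 else 0) = s + 1 := by
    split_ifs with h
    · have : Nat.card {y : F // y ^ (s + 1) = -∑ i, x i ^ (s + 1)} = 1 := by
        simp [h]
      rw [this]; ring
    · rw [card_norm_fiber hq (neg_ne_zero.mpr h) (sum_norm_pow hq x)]; simp
  have hm : hermitianZeros F s m =
      ∑ x : Fin m → F, if ∑ i, x i ^ (s + 1) = 0 then 1 else 0 := by
    rw [hermitianZeros, Nat.card_eq_fintype_card, Fintype.card_subtype, Finset.card_filter]
  rw [hm, hermitianZeros, Nat.card_congr e, Nat.card_sigma, Finset.mul_sum,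
    ← Finset.sum_add_distrib, Finset.sum_congr rfl fun x _ => hfib x]
  simp [hq, mul_comm]

theorem hermitianZeros_even (hq : Fintype.card F = s ^ 2) (h : ℕ) :
    (hermitianZeros F s (2 * h + 2) : ℤ) =
      s * (s ^ 2) ^ (2 * h + 1) - s * (s ^ 2) ^ h + (s ^ 2) ^ (h + 1) := by
  have step (m : ℕ) : (hermitianZeros F s (m + 1) : ℤ) =
      (s + 1) * (s ^ 2) ^ m - s * hermitianZeros F s m := by
    have := hermitianZeros_succ (F := F) hq m
    rw [eq_sub_iff_add_eq]
    exact_mod_cast this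
  induction h with
  | zero =>
    rw [step, step, hermitianZeros_zero]
    push_cast
    ring
  | succ h ih =>
    rw [show 2 * (h + 1) + 2 = 2 * h + 2 + 1 + 1 by ring, step, step, ih]
    ring

end HermitianForm

section ProjectiveCount

variable {F V : Type*} [Field F] [AddCommGroup V] [Module F V]

theorem card_projectivization_rep_mul_card_units (P : V → Prop)
    (hP : ∀ (u : Fˣ) (v : V), P v → P (u • v)) :
    Nat.card {p : Projectivization F V // P p.rep} * Nat.card Fˣ =
      Nat.card {v : V // v ≠ 0 ∧ P v} := by
  rw [← Nat.card_prod]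
  refine Nat.card_congr (Equiv.ofBijective
    (fun z => ⟨z.2 • z.1.1.rep, (smul_ne_zero_iff_ne _).mpr z.1.1.rep_nonzero, hP _ _ z.1.2⟩)
    ⟨?_, ?_⟩)
  · rintro ⟨⟨p, hp⟩, u⟩ ⟨⟨p', hp'⟩, u'⟩ h
    have h : u • p.rep = u' • p'.rep := congrArg Subtype.val h
    have hpp : p = p' := by
      rw [← p.mk_rep, ← p'.mk_rep, Projectivization.mk_eq_mk_iff]
      exact ⟨u⁻¹ * u', by rw [mul_smul, ← h, inv_smul_smul]⟩
    subst hpp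
    have hu : u = u' := Units.ext (smul_left_injective F p.rep_nonzero h)
    rw [hu]
  · rintro ⟨v, hv, hPv⟩
    obtain ⟨a, ha⟩ := Projectivization.exists_smul_eq_mk_rep F v hv
    refine ⟨⟨⟨Projectivization.mk F v hv, ha ▸ hP a v hPv⟩, a⁻¹⟩, Subtype.ext ?_⟩
    simp [← ha]

end ProjectiveCount

section HermitianVariety

variable {F : Type*} [Field F]

theorem eval_hermitian {m s : ℕ} (v : Fin m → F) :
    MvPolynomial.eval v (∑ i, MvPolynomial.X i ^ (s + 1)) = ∑ i, v i ^ (s + 1) := by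
  simp

variable [Fintype F] {s : ℕ}

theorem numPoints_hermitian (hq : Fintype.card F = s ^ 2) (m : ℕ) :
    numPoints (∑ i : Fin m, MvPolynomial.X i ^ (s + 1) : MvPolynomial (Fin m) F) * (s ^ 2 - 1) + 1 =
      hermitianZeros F s m := by
  classical
  unfold numPoints
  simp only [eval_hermitian]
  have hu : s ^ 2 - 1 = Nat.card Fˣ := by
    rw [Nat.card_eq_fintype_card, Fintype.card_units, hq]
  rw [hu, card_projectivization_rep_mul_card_units (fun v : Fin m → F => ∑ i, v i ^ (s + 1) = 0)]
  · rw [hermitianZeros, Nat.card_eq_fintype_card, Nat.card_eq_fintype_card, Fintype.card_subtype,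
      Fintype.card_subtype, ← Finset.card_erase_add_one (s := {x : Fin m → F | ∑ i, x i ^ (s + 1) = 0}) (a := 0) (by simp)]
    congr 2
    ext v
    simp
  · intro u v hv
    simp only [Pi.smul_apply, Units.smul_def, smul_eq_mul, mul_pow, ← Finset.mul_sum, hv, mul_zero]

theorem exists_isotropic_subspace (hq : Fintype.card F = s ^ 2) (h : ℕ) :
    ∃ W : Submodule F (Fin (2 * h + 2) → F), Module.finrank F W = h + 1 ∧
      ∀ v ∈ W, ∑ i, v i ^ (s + 1) = 0 := by
  obtain ⟨σ, hσ⟩ := exists_ringHom_pow hq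
  have hfib := card_norm_fiber hq (c := -1) (neg_ne_zero.mpr one_ne_zero) (by rw [← hσ]; simp)
  obtain ⟨⟨a, ha⟩⟩ : Nonempty {y : F // y ^ (s + 1) = -1} := by
    by_contra hne
    rw [not_nonempty_iff] at hne
    simp at hfib
  let e : Fin (2 * h + 2) ≃ Fin (h + 1) ⊕ Fin (h + 1) :=
    (finCongr (by ring)).trans finSumFinEquiv.symm
  let T : (Fin (h + 1) → F) →ₗ[F] (Fin (2 * h + 2) → F) :=
    { toFun := fun u i => Sum.elim u (a • u) (e i)
      map_add' := fun u v => by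
        ext i
        rcases he : e i with j | j <;> simp [he]
      map_smul' := fun c u => by
        ext i
        rcases he : e i with j | j <;> simp [he, mul_left_comm] }
  have hT : Function.Injective T := fun u v huv => by
    ext j
    have := congrFun huv (e.symm (Sum.inl j))
    simpa [T] using this
  refine ⟨LinearMap.range T, ?_, ?_⟩
  · rw [LinearMap.finrank_range_of_inj hT]; simp
  · rintro _ ⟨u, rfl⟩
    change ∑ i, (Sum.elim u (a • u) (e i)) ^ (s + 1) = 0
    rw [e.sum_comp (fun z => (Sum.elim u (a • u) z) ^ (s + 1)), Fintype.sum_sum_type]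
    simp [mul_pow, ha]

theorem two_mul_finrank_isotropic_le (hq : Fintype.card F = s ^ 2) {m : ℕ}
    (W : Submodule F (Fin m → F)) (hW : ∀ v ∈ W, ∑ i, v i ^ (s + 1) = 0) :
    2 * Module.finrank F W ≤ m := by
  classical
  obtain ⟨σ, hσ⟩ := exists_ringHom_pow hq
  have hσσ (x : F) : σ (σ x) = x := by rw [hσ, hσ, pow_pow_of_card_eq_sq hq]
  have hs := two_le_of_card_eq_sq hq
  obtain ⟨c, hc⟩ : ∃ c : F, c ≠ σ c := by
    obtain ⟨g, hg⟩ := IsCyclic.exists_generator (α := Fˣ)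
    refine ⟨g, fun hgs => ?_⟩
    have h1 : g ^ (s - 1) = 1 := by
      have h2 : g * g ^ (s - 1) = g := by
        rw [← pow_succ', Nat.sub_add_cancel (by omega)]
        ext
        rw [Units.val_pow_eq_pow_val, ← hσ, ← hgs]
      exact mul_eq_left.mp h2
    have h2 := orderOf_dvd_of_pow_eq_one h1
    rw [orderOf_eq_card_of_forall_mem_zpowers hg, Nat.card_eq_fintype_card, Fintype.card_units,
      hq] at h2
    have h3 := Nat.le_of_dvd (by omega) h2
    have : s < s ^ 2 := by nlinarith
    omega
  have hnorm (v : Fin m → F) (hv : v ∈ W) : ∑ i, v i * σ (v i) = 0 := by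
    simpa only [hσ, ← pow_succ'] using hW v hv
  have hpol (u v : Fin m → F) (hu : u ∈ W) (hv : v ∈ W) :
      ∑ i, u i * σ (v i) + ∑ i, v i * σ (u i) = 0 := by
    have h1 := hnorm (u + v) (W.add_mem hu hv)
    have h2 := hnorm u hu
    have h3 := hnorm v hv
    simp only [Pi.add_apply, map_add, add_mul, mul_add, Finset.sum_add_distrib] at h1
    linear_combination h1 - h2 - h3
  have horth (u v : Fin m → F) (hu : u ∈ W) (hv : v ∈ W) : ∑ i, σ (v i) * u i = 0 := by
    have h1 := hpol u v hu hv
    have h2 := hpol (c • u) v (W.smul_mem c hu) hv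
    simp only [Pi.smul_apply, smul_eq_mul, map_mul, mul_assoc, mul_left_comm _ (σ c),
      ← Finset.mul_sum] at h2
    have h3 : (c - σ c) * ∑ i, u i * σ (v i) = 0 := by linear_combination h2 - σ c * h1
    have h4 := (mul_eq_zero.mp h3).resolve_left (sub_ne_zero.mpr hc)
    simpa only [mul_comm] using h4
  let b := Module.finBasis F W
  let M : Matrix (Fin (Module.finrank F W)) (Fin m) F := fun j i => σ ((b j : Fin m → F) i)
  have hrows : LinearIndependent F M := by
    rw [Fintype.linearIndependent_iff]
    intro g hg j
    have h1 : ∑ j, σ (g j) • b j = 0 := by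
      ext i
      have := congrArg σ (congrFun hg i)
      simpa [M, hσσ, Finset.sum_apply] using this
    have h2 := Fintype.linearIndependent_iff.mp b.linearIndependent _ h1 j
    simpa using h2
  have hrank : Module.finrank F (LinearMap.range M.mulVecLin) = Module.finrank F W := by
    have := LinearIndependent.rank_matrix (M := M) hrows
    simpa [Matrix.rank] using this
  have hker : W ≤ LinearMap.ker M.mulVecLin := fun u hu => by
    ext j
    exact horth u (b j) hu (b j).2
  have h1 := LinearMap.finrank_range_add_finrank_ker M.mulVecLin
  have h2 := Submodule.finrank_mono hker
  rw [hrank, Module.finrank_fin_fun] at h1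
  omega

end HermitianVariety

theorem NP_mul_sub_one (q N : ℕ) : (NP q N : ℤ) * (q - 1) = q ^ (N + 1) - 1 := by
  simp only [NP]
  push_cast
  exact geom_sum_mul (q : ℤ) (N + 1)

theorem stmt16 {F : Type*} [Field F] [Fintype F] {s h : ℕ}
    (hq : Fintype.card F = s ^ 2) (hh : 1 ≤ h) :
    ThasEq (∑ i : Fin (2 * h + 2), MvPolynomial.X i ^ (s + 1) :
        MvPolynomial (Fin (2 * h + 2)) F) h ∧
    numPoints (∑ i : Fin (2 * h + 2), MvPolynomial.X i ^ (s + 1) :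
        MvPolynomial (Fin (2 * h + 2)) F)
      = (s * Fintype.card F ^ h + 1) * NP (Fintype.card F) h ∧
    (s * Fintype.card F ^ h + 1) * NP (Fintype.card F) h
      = Theta (Fintype.card F) (s + 1) (2 * h) h := by
  have hs := two_le_of_card_eq_sq hq
  refine ⟨⟨?_, ?_⟩, ?_, ?_⟩
  · obtain ⟨W, hW, hWs⟩ := exists_isotropic_subspace hq h
    exact ⟨W, hW, fun v hv => (eval_hermitian v).trans (hWs v hv)⟩
  · rintro ⟨W, hW, hWs⟩
    have := two_mul_finrank_isotropic_le hq W fun v hv => (eval_hermitian v).symm.trans (hWs v hv)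
    omega
  · have h1 := numPoints_hermitian hq (2 * h + 2)
    have h2 := hermitianZeros_even hq h
    have h3 := NP_mul_sub_one (s ^ 2) h
    rw [← h1] at h2
    rw [hq]
    have hpos : 1 ≤ s ^ 2 := Nat.one_le_pow _ _ (by omega)
    have hne : ((s : ℤ) ^ 2 - 1) ≠ 0 := by
      have : (2 : ℤ) ≤ s := by exact_mod_cast hs
      nlinarith
    zify
    refine mul_right_cancel₀ hne ?_
    push_cast [Nat.cast_sub hpos] at h2 h3 ⊢
    linear_combination h2 - (s * (s ^ 2) ^ h + 1) * h3
  · simp only [Theta, Nat.add_sub_cancel, show 2 * h - h = h by omega]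
    ring
end
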